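/- arXiv:1504.02003 — 7 statements merged into one kernel-verified Lean document; each statement's English description precedes it below -/
import Mathlib

section
/- For every multiindex n ∈ ℕ^d, L(u₀ X̃_{2n}) = 2|n|(2|n|−1) · u₀ · Σ_{i=1}^d rᵢ X̃_{2n−2δᵢ} on [x₁, x₂]. -/
open Set in
/-- A function given on a compact interval by a multiple of the primitive of a function continuous
there is differentiable within the interval. -/
theorem hasDerivWithinAt_of_eq_const_mul_integral {a b x₀ x : ℝ} {F f : ℝ → ℂ} {c : ℂ}
    (hx₀ : x₀ ∈ Icc a b) (hx : x ∈ Icc a b) (hf : ContinuousOn f (Icc a b))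
    (hF : ∀ y ∈ Icc a b, F y = c * ∫ t in x₀..y, f t) :
    HasDerivWithinAt F (c * f x) (Icc a b) x := by
  have : Fact (x ∈ Icc a b) := ⟨hx⟩
  have hint : IntervalIntegrable f MeasureTheory.volume x₀ x :=
    (hf.mono (uIcc_subset_Icc hx₀ hx)).intervalIntegrable
  have h := intervalIntegral.integral_hasDerivWithinAt_right (s := Icc a b) (t := Icc a b) hint
    (hf.stronglyMeasurableAtFilter_nhdsWithin measurableSet_Icc x) (hf x hx)
  exact (h.const_mul c).congr hF (hF x hx)

/-- The formal powers with admissible multiindex are continuous. -/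
theorem continuousOn_formalPower
    {d : ℕ} {x₁ x₂ x₀ : ℝ} (hx₀ : x₀ ∈ Set.Icc x₁ x₂) {v : ℝ → ℂ} {w : Fin d → ℝ → ℂ}
    (hv : ContinuousOn v (Set.Icc x₁ x₂)) (hw : ∀ i, ContinuousOn (w i) (Set.Icc x₁ x₂))
    {Xt : (Fin d → ℤ) → ℝ → ℂ}
    (hXt0 : ∀ x, Xt 0 x = 1)
    (hXtneg : ∀ j : Fin d → ℤ, (∃ i, j i < 0) → ∀ x, Xt j x = 0)
    (hXtodd : ∀ j : Fin d → ℤ, (∀ i, 0 ≤ j i) →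
      (∀ i i', Odd (j i) → Odd (j i') → i = i') →
      ∀ i, Odd (j i) → ∀ x ∈ Set.Icc x₁ x₂,
        Xt j x = (((∑ i', j i') : ℤ) : ℂ) *
          ∫ t in x₀..x, w i t * Xt (j - Pi.single i 1) t)
    (hXteven : ∀ j : Fin d → ℤ, (∀ i, 0 ≤ j i) →
      (∀ i i', Odd (j i) → Odd (j i') → i = i') →
      Even (∑ i, j i) → j ≠ 0 → ∀ x ∈ Set.Icc x₁ x₂,
        Xt j x = (((∑ i, j i) : ℤ) : ℂ) *
          ∫ t in x₀..x, v t * ∑ i, Xt (j - Pi.single i 1) t)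
    (j : Fin d → ℤ) (hj : ∀ i i', Odd (j i) → Odd (j i') → i = i') :
    ContinuousOn (Xt j) (Set.Icc x₁ x₂) := by
  induction hN : (∑ i, j i).toNat using Nat.strong_induction_on generalizing j with
  | _ N ih =>
  by_cases hneg : ∃ i, j i < 0
  · exact continuousOn_const.congr fun x _ => hXtneg j hneg x
  push Not at hneg
  have hsum (i : Fin d) : ∑ k, (j - Pi.single i 1 : Fin d → ℤ) k = ∑ k, j k - 1 := by simp
  have hle (i : Fin d) : j i ≤ ∑ k, j k :=
    Finset.single_le_sum (fun k _ => hneg k) (Finset.mem_univ i)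
  by_cases hodd : ∃ i, Odd (j i)
  · obtain ⟨i, hi⟩ := hodd
    have hlow : ContinuousOn (Xt (j - Pi.single i 1)) (Set.Icc x₁ x₂) := by
      refine ih _ ?_ _ ?_ rfl
      · have := hle i
        have := hneg i
        have : j i ≠ 0 := fun h => by simp [h] at hi
        rw [hsum]
        omega
      · intro k k' hk hk'
        exfalso
        rcases eq_or_ne k i with rfl | hki
        · simp only [Pi.sub_apply, Pi.single_eq_same] at hk
          exact (Int.not_even_iff_odd.2 hk) (hi.sub_odd odd_one)
        · simp only [Pi.sub_apply, Pi.single_eq_of_ne hki, sub_zero] at hk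
          exact hki (hj k i hk hi)
    exact fun x hx => (hasDerivWithinAt_of_eq_const_mul_integral hx₀ hx ((hw i).mul hlow)
      (hXtodd j hneg hj i hi)).continuousWithinAt
  · push Not at hodd
    have heven (i : Fin d) : Even (j i) := Int.not_odd_iff_even.1 (hodd i)
    rcases eq_or_ne j 0 with rfl | hj0
    · exact continuousOn_const.congr fun x _ => hXt0 x
    have hlow (i : Fin d) : ContinuousOn (Xt (j - Pi.single i 1)) (Set.Icc x₁ x₂) := by
      refine ih _ ?_ _ ?_ rfl
      · obtain ⟨k, hk⟩ := Function.ne_iff.1 hj0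
        have := hle k
        have := hneg k
        have : j k ≠ 0 := hk
        rw [hsum]
        omega
      · have key (k : Fin d) (hk : Odd ((j - Pi.single i 1 : Fin d → ℤ) k)) : k = i := by
          by_contra hki
          simp only [Pi.sub_apply, Pi.single_eq_of_ne hki, sub_zero] at hk
          exact hodd k hk
        intro k k' hk hk'
        rw [key k hk, key k' hk']
    exact fun x hx => (hasDerivWithinAt_of_eq_const_mul_integral hx₀ hx
      (hv.mul (continuousOn_finsetSum _ fun i _ => hlow i))
      (hXteven j hneg hj (Finset.even_sum _ fun i _ => heven i) hj0)).continuousWithinAt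


/-- **Lemma on `L(u₀ X̃_{2n})`.**  With the formal powers `X̃_j` (here `Xt j`) defined by the
SPPS recursion (a multiindex `j ∈ ℤ^d` is *admissible* when at most one entry is odd, and an
admissible `j` is *odd*/*even* according to the parity of `|j| = Σ jᵢ`):
`X̃_0 = 1`; `X̃_j = 0` if some entry is negative; for admissible `j ≥ 0`,
`X̃_j = |j| ∫_{x₀}^x rᵢ u₀² X̃_{j−δᵢ}` when `j` is odd with odd entry in position `i`, and
`X̃_j = |j| ∫_{x₀}^x (1/(p u₀²)) Σᵢ X̃_{j−δᵢ}` when `j` is even;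
one has, for every `n ∈ ℕ^d`,
`L(u₀ X̃_{2n}) = 2|n|(2|n|−1) u₀ Σᵢ rᵢ X̃_{2n−2δᵢ}` on `[x₁, x₂]`,
where `L y = (p y′)′ + q y` (derivatives within `[x₁, x₂]`). -/
theorem Lu0Xt_formula
    (d : ℕ) (hd : 1 ≤ d)
    (x₁ x₂ x₀ : ℝ) (hx : x₁ < x₂) (hx₀ : x₀ ∈ Set.Icc x₁ x₂)
    (p q u₀ : ℝ → ℂ) (r : Fin d → ℝ → ℂ)
    (hp : ContDiffOn ℝ 1 p (Set.Icc x₁ x₂))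
    (hq : ContinuousOn q (Set.Icc x₁ x₂))
    (hr : ∀ i, ContinuousOn (r i) (Set.Icc x₁ x₂))
    (hpne : ∀ x ∈ Set.Icc x₁ x₂, p x ≠ 0)
    (hu₀ : ContDiffOn ℝ 2 u₀ (Set.Icc x₁ x₂))
    (hu₀ne : ∀ x ∈ Set.Icc x₁ x₂, u₀ x ≠ 0)
    (hu₀sol : ∀ x ∈ Set.Icc x₁ x₂,
      derivWithin (fun t => p t * derivWithin u₀ (Set.Icc x₁ x₂) t) (Set.Icc x₁ x₂) x
        + q x * u₀ x = 0)
    (Xt : (Fin d → ℤ) → ℝ → ℂ)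
    (hXt0 : ∀ x, Xt 0 x = 1)
    (hXtneg : ∀ j : Fin d → ℤ, (∃ i, j i < 0) → ∀ x, Xt j x = 0)
    (hXtodd : ∀ j : Fin d → ℤ, (∀ i, 0 ≤ j i) →
      (∀ i i', Odd (j i) → Odd (j i') → i = i') →
      ∀ i, Odd (j i) → ∀ x ∈ Set.Icc x₁ x₂,
        Xt j x = (((∑ i', j i') : ℤ) : ℂ) *
          ∫ t in x₀..x, r i t * u₀ t ^ 2 * Xt (j - Pi.single i 1) t)
    (hXteven : ∀ j : Fin d → ℤ, (∀ i, 0 ≤ j i) →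
      (∀ i i', Odd (j i) → Odd (j i') → i = i') →
      Even (∑ i, j i) → j ≠ 0 → ∀ x ∈ Set.Icc x₁ x₂,
        Xt j x = (((∑ i, j i) : ℤ) : ℂ) *
          ∫ t in x₀..x, (1 / (p t * u₀ t ^ 2)) * ∑ i, Xt (j - Pi.single i 1) t) :
    ∀ n : Fin d → ℕ, ∀ x ∈ Set.Icc x₁ x₂,
      derivWithin (fun t => p t *
          derivWithin (fun s => u₀ s * Xt (fun i => (2 * n i : ℤ)) s) (Set.Icc x₁ x₂) t)
          (Set.Icc x₁ x₂) x
        + q x * (u₀ x * Xt (fun i => (2 * n i : ℤ)) x)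
      = (2 * ∑ i, (n i : ℂ)) * (2 * ∑ i, (n i : ℂ) - 1) * u₀ x *
          ∑ i, r i x * Xt ((fun i' => (2 * n i' : ℤ)) - Pi.single i 2) x := by
  intro n
  set I := Set.Icc x₁ x₂
  have hU : UniqueDiffOn ℝ I := uniqueDiffOn_Icc hx
  set j : Fin d → ℤ := fun i => (2 * n i : ℤ) with hj
  set M : ℂ := 2 * ∑ i, (n i : ℂ) with hM
  have hsumj : (((∑ i, j i) : ℤ) : ℂ) = M := by
    simp [hj, hM, Finset.mul_sum]
  have hnonneg (i : Fin d) : 0 ≤ j i := by simp [hj]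
  have hjeven (i : Fin d) : Even (j i) := even_two_mul _
  have hjodd (i : Fin d) : ¬ Odd (j i) := Int.not_odd_iff_even.2 (hjeven i)
  have hlowodd (i k : Fin d) (hk : Odd ((j - Pi.single i 1 : Fin d → ℤ) k)) : k = i := by
    by_contra hki
    simp only [Pi.sub_apply, Pi.single_eq_of_ne hki, sub_zero] at hk
    exact hjodd k hk
  have hlowadm (i k k' : Fin d) (hk : Odd ((j - Pi.single i 1 : Fin d → ℤ) k))
      (hk' : Odd ((j - Pi.single i 1 : Fin d → ℤ) k')) : k = k' := by
    rw [hlowodd i k hk, hlowodd i k' hk']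
  have hlow2 (i k : Fin d) : ¬ Odd ((j - Pi.single i 2 : Fin d → ℤ) k) := by
    rw [Int.not_odd_iff_even]
    refine (hjeven k).sub ?_
    rcases eq_or_ne k i with rfl | hki
    · simp
    · simp [Pi.single_eq_of_ne hki]
  have hv : ContinuousOn (fun t => 1 / (p t * u₀ t ^ 2)) I :=
    continuousOn_const.div (hp.continuousOn.mul (hu₀.continuousOn.pow 2))
      fun t ht => mul_ne_zero (hpne t ht) (pow_ne_zero 2 (hu₀ne t ht))
  have hw (i : Fin d) : ContinuousOn (fun t => r i t * u₀ t ^ 2) I :=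
    (hr i).mul (hu₀.continuousOn.pow 2)
  have hcont := continuousOn_formalPower hx₀ hv hw hXt0 hXtneg hXtodd hXteven
  have hdodd (i : Fin d) (x : ℝ) (hxI : x ∈ I) :
      HasDerivWithinAt (Xt (j - Pi.single i 1))
        ((M - 1) * (r i x * u₀ x ^ 2 * Xt (j - Pi.single i 2) x)) I x := by
    rcases Nat.eq_zero_or_pos (n i) with h0 | hpos
    · have h1 : ∀ y, Xt (j - Pi.single i 1) y = 0 := hXtneg _ ⟨i, by simp [hj, h0]⟩
      have h2 : ∀ y, Xt (j - Pi.single i 2) y = 0 := hXtneg _ ⟨i, by simp [hj, h0]⟩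
      rw [h2, mul_zero, mul_zero]
      exact (hasDerivWithinAt_const x I (0 : ℂ)).congr (fun y _ => h1 y) (h1 x)
    · have hss : j - Pi.single i 1 - Pi.single i 1 = j - Pi.single i 2 := by
        rw [sub_sub, ← Pi.single_add]
        norm_num
      have hnn (k : Fin d) : 0 ≤ (j - Pi.single i 1 : Fin d → ℤ) k := by
        rcases eq_or_ne k i with rfl | hki
        · simp only [hj, Pi.sub_apply, Pi.single_eq_same]
          omega
        · simpa only [Pi.sub_apply, Pi.single_eq_of_ne hki, sub_zero] using hnonneg k
      have hoi : Odd ((j - Pi.single i 1 : Fin d → ℤ) i) := by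
        simpa using (hjeven i).sub_odd odd_one
      have hs : (((∑ k, (j - Pi.single i 1 : Fin d → ℤ) k) : ℤ) : ℂ) = M - 1 := by
        rw [← hsumj]
        simp
      have heq := hXtodd _ hnn (hlowadm i) i hoi
      rw [hs, hss] at heq
      exact hasDerivWithinAt_of_eq_const_mul_integral hx₀ hxI
        ((hw i).mul (hcont _ fun k _ hk => absurd hk (hlow2 i k))) heq
  have hdeven (x : ℝ) (hxI : x ∈ I) :
      HasDerivWithinAt (Xt j)
        (M * (1 / (p x * u₀ x ^ 2) * ∑ i, Xt (j - Pi.single i 1) x)) I x := by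
    rcases eq_or_ne j 0 with h0 | hj0
    · have hM0 : M = 0 := by rw [← hsumj, h0]; simp
      rw [hM0, zero_mul, h0]
      exact (hasDerivWithinAt_const x I (1 : ℂ)).congr (fun y _ => hXt0 y) (hXt0 x)
    · have heq := hXteven j hnonneg (fun k _ hk => absurd hk (hjodd k))
        (Finset.even_sum _ fun i _ => hjeven i) hj0
      rw [hsumj] at heq
      exact hasDerivWithinAt_of_eq_const_mul_integral hx₀ hxI
        (hv.mul (continuousOn_finsetSum _ fun i _ => hcont _ (hlowadm i))) heq
  have hdu (x : ℝ) (hxI : x ∈ I) : HasDerivWithinAt u₀ (derivWithin u₀ I x) I x :=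
    (hu₀.differentiableOn (by norm_num) x hxI).hasDerivWithinAt
  have hdpu (x : ℝ) (hxI : x ∈ I) :
      HasDerivWithinAt (fun t => p t * derivWithin u₀ I t) (-(q x * u₀ x)) I x := by
    have hd1 : DifferentiableOn ℝ (fun t => p t * derivWithin u₀ I t) I :=
      (hp.differentiableOn (by norm_num)).mul
        ((hu₀.derivWithin hU (m := 1) (by norm_num)).differentiableOn (by norm_num))
    rw [← eq_neg_of_add_eq_zero_left (hu₀sol x hxI)]
    exact (hd1 x hxI).hasDerivWithinAt
  have hflux : ∀ t ∈ I, p t * derivWithin (fun s => u₀ s * Xt j s) I t =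
      p t * derivWithin u₀ I t * Xt j t + M * (∑ i, Xt (j - Pi.single i 1) t) / u₀ t := by
    intro t ht
    have h1 := hpne t ht
    have h2 := hu₀ne t ht
    rw [((hdu t ht).fun_mul (hdeven t ht)).derivWithin (hU t ht)]
    field_simp
  intro x hxI
  have h1 := hpne x hxI
  have h2 := hu₀ne x hxI
  have hS := HasDerivWithinAt.fun_sum (u := Finset.univ) fun i _ => hdodd i x hxI
  have hmain := ((hdpu x hxI).fun_mul (hdeven x hxI)).fun_add
    ((hS.const_mul M).fun_div (hdu x hxI) h2)
  rw [(hmain.congr hflux (hflux x hxI)).derivWithin (hU x hxI)]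
  have hsum : ∑ i, (M - 1) * (r i x * u₀ x ^ 2 * Xt (j - Pi.single i 2) x) =
      (M - 1) * u₀ x ^ 2 * ∑ i, r i x * Xt (j - Pi.single i 2) x := by
    rw [Finset.mul_sum]
    exact Finset.sum_congr rfl fun i _ => by ring
  rw [hsum]
  field_simp
  ring
end

section
/- For every admissible multiindex j ∈ ℤ^d with nonnegative entries, the number of nested-integral summands satisfies the closed formula c̃_j = [|j|/2]! / ( [j₁/2]! · [j₂/2]! ⋯ [j_d/2]! ), where [a] denotes the floor of a. -/
open Finset in
/-- Removing one unit from a positive coordinate divides the product of factorials by it. -/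
lemma prod_factorial_sub_single {ι : Type*} [Fintype ι] [DecidableEq ι] (a : ι → ℕ) (i : ι)
    (hi : 0 < a i) :
    ∏ k, (a k).factorial = a i * ∏ k, ((a - Pi.single i 1 : ι → ℕ) k).factorial := by
  have h (b : ι → ℕ) :
      ∏ k, (b k).factorial = (b i).factorial * ∏ k ∈ univ.erase i, (b k).factorial :=
    (mul_prod_erase univ (fun k => (b k).factorial) (mem_univ i)).symm
  rw [h a, h, ← mul_assoc]
  congr 1
  · simp [Nat.mul_factorial_pred hi.ne']
  · refine prod_congr rfl fun k hk => ?_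
    simp [Pi.single_eq_of_ne (ne_of_mem_erase hk)]

lemma sum_sub_single_add_one {ι : Type*} [Fintype ι] [DecidableEq ι] (a : ι → ℕ) (i : ι)
    (hi : 0 < a i) : ∑ k, (a - Pi.single i 1 : ι → ℕ) k + 1 = ∑ k, a k := by
  have h : a = (a - Pi.single i 1) + Pi.single i 1 := by
    ext k
    rcases eq_or_ne k i with rfl | hk
    · simp; omega
    · simp [hk]
  conv_rhs => rw [h]
  simp only [Pi.add_apply, Finset.sum_add_distrib]
  simp

/-- The multinomial recursion, with the boundary terms set to zero, has the multinomial
coefficients as its only solution. -/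
lemma mul_prod_factorial_of_recursion {ι : Type*} [Fintype ι] [DecidableEq ι]
    (C : (ι → ℕ) → ℕ) (h0 : C 0 = 1)
    (hC : ∀ a, a ≠ 0 → C a = ∑ i, if 0 < a i then C (a - Pi.single i 1) else 0) (a : ι → ℕ) :
    C a * ∏ i, (a i).factorial = (∑ i, a i).factorial := by
  induction hn : ∑ i, a i generalizing a with
  | zero =>
    have ha : a = 0 := by
      ext i
      simpa using Finset.sum_eq_zero_iff.1 hn i (Finset.mem_univ i)
    simp [ha, h0]
  | succ n ih =>
    have ha : a ≠ 0 := by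
      rintro rfl
      simp at hn
    rw [hC a ha, Finset.sum_mul, Nat.factorial_succ, ← hn, Finset.sum_mul]
    refine Finset.sum_congr rfl fun i _ => ?_
    split_ifs with hi
    · have hs := sum_sub_single_add_one a i hi
      rw [prod_factorial_sub_single a i hi, ← ih (a - Pi.single i 1) (by omega)]
      ring
    · simp [Nat.eq_zero_of_not_pos hi]

/-- **Closed formula for the number of nested-integral summands.**
Fix `d ≥ 1`.  For `j ∈ ℤ^d`, `j` is *admissible* when at most one entry is odd, and
an admissible `j` is *odd*/*even* according to the parity of `|j| = Σ jᵢ`.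
The counts `c̃_j` (here `ct j`) satisfy: `c̃_0 = 1`; `c̃_j = 0` if some entry is negative;
for admissible `j ≥ 0`, `c̃_j = c̃_{j−δᵢ}` when `j` is odd with odd entry in position `i`,
and `c̃_j = Σᵢ c̃_{j−δᵢ}` when `j` is even.  Then for every admissible `j ≥ 0`,
`c̃_j = [|j|/2]! / ([j₁/2]! ⋯ [j_d/2]!)`, where `[·]` is the floor. -/
theorem count_formula
    (d : ℕ) (hd : 1 ≤ d)
    (ct : (Fin d → ℤ) → ℕ)
    (hct0 : ct 0 = 1)
    (hctneg : ∀ j : Fin d → ℤ, (∃ i, j i < 0) → ct j = 0)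
    (hctodd : ∀ j : Fin d → ℤ, (∀ i, 0 ≤ j i) →
      (∀ i i', Odd (j i) → Odd (j i') → i = i') →
      ∀ i, Odd (j i) → ct j = ct (j - Pi.single i 1))
    (hcteven : ∀ j : Fin d → ℤ, (∀ i, 0 ≤ j i) →
      (∀ i i', Odd (j i) → Odd (j i') → i = i') →
      Even (∑ i, j i) → j ≠ 0 → ct j = ∑ i, ct (j - Pi.single i 1)) :
    ∀ j : Fin d → ℤ, (∀ i, 0 ≤ j i) →
      (∀ i i', Odd (j i) → Odd (j i') → i = i') →
      (ct j : ℚ) = (Nat.factorial ((∑ i, j i).toNat / 2) : ℚ) /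
          ∏ i, (Nat.factorial ((j i).toNat / 2) : ℚ) := by
  have hodd (a : Fin d → ℕ) (i : Fin d) :
      ct ((fun k => 2 * (a k : ℤ)) + Pi.single i 1) = ct (fun k => 2 * (a k : ℤ)) := by
    have hmem (k : Fin d) (hk : Odd (((fun k => 2 * (a k : ℤ)) + Pi.single i 1 : Fin d → ℤ) k)) :
        k = i := by
      by_contra hne
      simp [hne, Int.odd_iff] at hk
    rw [hctodd _ (fun k => ?_) (fun k k' hk hk' => (hmem k hk).trans (hmem k' hk').symm) i (by simp),
      add_sub_cancel_right]
    rcases eq_or_ne k i with rfl | hk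
    · simp; omega
    · simp [hk]
  have hrec (a : Fin d → ℕ) (ha : a ≠ 0) : ct (fun k => 2 * (a k : ℤ)) =
      ∑ i, if 0 < a i then ct (fun k => 2 * (((a - Pi.single i 1 : Fin d → ℕ) k : ℕ) : ℤ)) else 0 := by
    rw [hcteven _ (fun k => by positivity) (fun k k' hk => by simp [Int.odd_iff] at hk)
      (by simp [← Finset.mul_sum]) (fun h => ha ?_)]
    · refine Finset.sum_congr rfl fun i _ => ?_
      split_ifs with hi
      · rw [← hodd _ i]
        congr 1
        ext k
        rcases eq_or_ne k i with rfl | hk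
        · simp; omega
        · simp [hk]
      · exact hctneg _ ⟨i, by simp; omega⟩
    · ext k
      simpa using congrFun h k
  have hformula (a : Fin d → ℕ) :
      ct (fun k => 2 * (a k : ℤ)) * ∏ i, (a i).factorial = (∑ i, a i).factorial :=
    mul_prod_factorial_of_recursion (fun a => ct (fun k => 2 * (a k : ℤ)))
      (by simpa [Pi.zero_def] using hct0) hrec a
  intro j hj hadm
  set a : Fin d → ℕ := fun k => (j k).toNat / 2 with ha
  obtain ⟨hct, hsum⟩ : ct j = ct (fun k => 2 * (a k : ℤ)) ∧
      (∑ i, j i).toNat / 2 = ∑ i, a i := by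
    by_cases h : ∃ i, Odd (j i)
    · obtain ⟨i, hi⟩ := h
      have hja : j = (fun k => 2 * (a k : ℤ)) + Pi.single i 1 := by
        ext k
        have := hj k
        rcases eq_or_ne k i with rfl | hk
        · obtain ⟨m, hm⟩ := hi
          simp [ha]; omega
        · obtain ⟨m, hm⟩ := Int.not_odd_iff_even.1 fun hk' => hk (hadm k i hk' hi)
          simp [ha, hk]; omega
      have hs : ∑ k, j k = 2 * ((∑ k, a k : ℕ) : ℤ) + 1 := by
        rw [hja]
        simp only [Pi.add_apply, Finset.sum_add_distrib, ← Finset.mul_sum]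
        simp
      exact ⟨by rw [← hodd a i, ← hja], by omega⟩
    · have hja : j = fun k => 2 * (a k : ℤ) := by
        ext k
        have := hj k
        obtain ⟨m, hm⟩ := Int.not_odd_iff_even.1 fun hk => h ⟨k, hk⟩
        simp [ha]; omega
      have hs : ∑ k, j k = 2 * ((∑ k, a k : ℕ) : ℤ) := by
        rw [Nat.cast_sum, Finset.mul_sum]
        exact Finset.sum_congr rfl fun k _ => congrFun hja k
      exact ⟨by rw [← hja], by omega⟩
  rw [hct, hsum, eq_div_iff (Finset.prod_ne_zero_iff.2 fun i _ => by positivity)]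
  exact_mod_cast hformula a
end

section
/- For every multiindex n ∈ ℕ^d, L(u₀ X_{2n+(1/d)𝟙}) = (2|n|+1)(2|n|) · u₀ · Σ_{i=1}^d rᵢ X_{2n−2δᵢ+(1/d)𝟙} on [x₁, x₂]. -/
open Set

/-- Fundamental theorem of calculus on a compact interval, with one-sided derivatives at the
endpoints. -/
lemma hasDerivWithinAt_integral_Icc {a b c : ℝ} {f : ℝ → ℂ} (hf : ContinuousOn f (Icc a b))
    (hc : c ∈ Icc a b) {x : ℝ} (hx : x ∈ Icc a b) :
    HasDerivWithinAt (fun y => ∫ t in c..y, f t) (f x) (Icc a b) x := by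
  have hab : a ≤ b := hc.1.trans hc.2
  set g : ℝ → ℂ := IccExtend hab ((Icc a b).domRestrict f) with hg
  have hgc : Continuous g := (continuousOn_iff_continuous_domRestrict.1 hf).Icc_extend'
  have hgf : ∀ y ∈ Icc a b, g y = f y := fun y hy => by
    rw [hg, IccExtend_of_mem hab _ hy]; rfl
  have hd : HasDerivWithinAt (fun y => ∫ t in c..y, g t) (g x) (Icc a b) x :=
    (hgc.integral_hasStrictDerivAt c x).hasDerivAt.hasDerivWithinAt
  rw [hgf x hx] at hd
  have heq : ∀ y ∈ Icc a b, ∫ t in c..y, f t = ∫ t in c..y, g t := fun y hy =>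
    intervalIntegral.integral_congr fun t ht => (hgf t (uIcc_subset_Icc hc hy ht)).symm
  exact hd.congr heq (heq x hx)

/-- The Sturm–Liouville operator with coefficients `p` and `q`, applied to a product `u X`, where `u` is a nonvanishing
solution of the homogeneous equation and `p u²` times the derivative of `X` is `c Y`. -/
lemma sturmLiouville_mul_eq {S : Set ℝ} (hS : UniqueDiffOn ℝ S) {p q u X Y Y' : ℝ → ℂ} {c : ℂ}
    (hpne : ∀ x ∈ S, p x ≠ 0) (hune : ∀ x ∈ S, u x ≠ 0)
    (hu : DifferentiableOn ℝ u S)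
    (hpu : DifferentiableOn ℝ (fun t => p t * derivWithin u S t) S)
    (hsol : ∀ x ∈ S, derivWithin (fun t => p t * derivWithin u S t) S x + q x * u x = 0)
    (hX : ∀ x ∈ S, HasDerivWithinAt X (c * (1 / (p x * u x ^ 2) * Y x)) S x)
    (hY : ∀ x ∈ S, HasDerivWithinAt Y (Y' x) S x) {x : ℝ} (hx : x ∈ S) :
    derivWithin (fun t => p t * derivWithin (fun s => u s * X s) S t) S x + q x * (u x * X x)
      = c * Y' x / u x := by
  have hflux : ∀ t ∈ S, p t * derivWithin (fun s => u s * X s) S t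
      = p t * derivWithin u S t * X t + c * Y t * (u t)⁻¹ := fun t ht => by
    have h1 := hpne t ht
    have h2 := hune t ht
    rw [((hu t ht).hasDerivWithinAt.fun_mul (hX t ht)).derivWithin (hS t ht)]
    field_simp
  have h1 := hpne x hx
  have h2 := hune x hx
  have hd := ((hpu x hx).hasDerivWithinAt.fun_mul (hX x hx)).fun_add
    (((hY x hx).const_mul c).fun_mul ((hu x hx).hasDerivWithinAt.fun_inv h2))
  rw [(hd.congr hflux (hflux x hx)).derivWithin (hS x hx)]
  have h3 := hsol x hx
  generalize derivWithin (fun t => p t * derivWithin u S t) S x = w at h3 ⊢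
  obtain rfl : w = -(q x * u x) := eq_neg_of_add_eq_zero_left h3
  field_simp
  ring

/-- The formal powers with index `2n - δᵢ` or `2n` are differentiable, with the derivatives
prescribed by the recursion. -/
lemma formalPower_hasDerivWithinAt {d : ℕ} {x₁ x₂ x₀ : ℝ} (hx₀ : x₀ ∈ Icc x₁ x₂)
    {p u₀ : ℝ → ℂ} {r : Fin d → ℝ → ℂ}
    (hp : ContinuousOn p (Icc x₁ x₂)) (hr : ∀ i, ContinuousOn (r i) (Icc x₁ x₂))
    (hpne : ∀ x ∈ Icc x₁ x₂, p x ≠ 0) (hu₀ : ContinuousOn u₀ (Icc x₁ x₂))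
    (hu₀ne : ∀ x ∈ Icc x₁ x₂, u₀ x ≠ 0)
    {X : (Fin d → ℤ) → ℝ → ℂ}
    (hX0 : ∀ i : Fin d, ∀ x, X (-Pi.single i 1) x = 1 / (d : ℂ))
    (hXneg : ∀ m : Fin d → ℤ, (∃ i, m i < 0) → (∀ i, m ≠ -Pi.single i 1) →
      ∀ x, X m x = 0)
    (hXr : ∀ m : Fin d → ℤ, (∀ i, 0 ≤ m i) →
      (∀ i i', Odd (m i) → Odd (m i') → i = i') →
      ∀ i, Odd (m i) → ∀ x ∈ Icc x₁ x₂,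
        X m x = (((∑ i', m i') + 1 : ℤ) : ℂ) *
          ∫ t in x₀..x, r i t * u₀ t ^ 2 * X (m - Pi.single i 1) t)
    (hXp : ∀ m : Fin d → ℤ, (∀ i, 0 ≤ m i) →
      (∀ i i', Odd (m i) → Odd (m i') → i = i') →
      Even (∑ i, m i) → ∀ x ∈ Icc x₁ x₂,
        X m x = (((∑ i, m i) + 1 : ℤ) : ℂ) *
          ∫ t in x₀..x, (1 / (p t * u₀ t ^ 2)) * ∑ i, X (m - Pi.single i 1) t)
    (n : Fin d → ℕ) :
    (∀ i, ∀ x ∈ Icc x₁ x₂,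
      HasDerivWithinAt (X ((fun i' => (2 * n i' : ℤ)) - Pi.single i 1))
        ((2 * ∑ i', (n i' : ℂ)) *
          (r i x * u₀ x ^ 2 * X ((fun i' => (2 * n i' : ℤ)) - Pi.single i 2) x))
        (Icc x₁ x₂) x) ∧
    ∀ x ∈ Icc x₁ x₂,
      HasDerivWithinAt (X (fun i => (2 * n i : ℤ)))
        ((2 * ∑ i, (n i : ℂ) + 1) * (1 / (p x * u₀ x ^ 2) *
          ∑ i, X ((fun i' => (2 * n i' : ℤ)) - Pi.single i 1) x)) (Icc x₁ x₂) x := by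
  induction n using WellFoundedLT.induction with
  | ind n ih =>
  have hodd : ∀ i, ∀ x ∈ Icc x₁ x₂,
      HasDerivWithinAt (X ((fun i' => (2 * n i' : ℤ)) - Pi.single i 1))
        ((2 * ∑ i', (n i' : ℂ)) *
          (r i x * u₀ x ^ 2 * X ((fun i' => (2 * n i' : ℤ)) - Pi.single i 2) x))
        (Icc x₁ x₂) x := by
    intro i x hx
    rcases Nat.eq_zero_or_pos (n i) with hi | hi
    · by_cases hn : n = 0
      · subst hn
        have h : X ((fun i' => (2 * (0 : Fin d → ℕ) i' : ℤ)) - Pi.single i 1)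
            = fun _ => 1 / (d : ℂ) := by
          funext y
          rw [← hX0 i y]
          congr 1
          ext k
          simp
        rw [h]
        simpa using hasDerivWithinAt_const x (Icc x₁ x₂) (1 / (d : ℂ))
      · obtain ⟨k, hk⟩ := Function.ne_iff.1 hn
        have hk : n k ≠ 0 := hk
        have hki : k ≠ i := fun h => hk (h ▸ hi)
        have h1 : X ((fun i' => (2 * n i' : ℤ)) - Pi.single i 1) = fun _ => 0 := by
          funext y
          refine hXneg _ ⟨i, by simp [hi]⟩ (fun j hj => ?_) y
          have := congrFun hj k
          by_cases hkj : k = j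
          · subst hkj
            simp [hki] at this
            omega
          · simp [hki, hkj] at this
            omega
        have h2 : X ((fun i' => (2 * n i' : ℤ)) - Pi.single i 2) x = 0 := by
          refine hXneg _ ⟨i, by simp [hi]⟩ (fun j hj => ?_) x
          have := congrFun hj i
          by_cases hij : i = j
          · subst hij
            simp [hi] at this
          · simp [hi, hij] at this
        rw [h1, h2]
        simpa using hasDerivWithinAt_const x (Icc x₁ x₂) (0 : ℂ)
    · have hlt : n - Pi.single i 1 < n := by
        refine lt_of_le_of_ne tsub_le_self fun h => ?_
        have := congrFun h i
        simp at this
        omega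
      have hidx : (fun i' => (2 * ((n - Pi.single i 1 : Fin d → ℕ) i' : ℕ) : ℤ))
          = (fun i' => (2 * n i' : ℤ)) - Pi.single i 2 := by
        ext k
        by_cases hk : k = i
        · subst hk
          simp
          omega
        · simp [hk]
      have hcont : ContinuousOn (X ((fun i' => (2 * n i' : ℤ)) - Pi.single i 2)) (Icc x₁ x₂) := by
        rw [← hidx]
        exact fun y hy => ((ih _ hlt).2 y hy).continuousWithinAt
      have hval : ∀ k, ((fun i' => (2 * n i' : ℤ)) - Pi.single i 1 : Fin d → ℤ) k
          = if k = i then (2 * n i - 1 : ℤ) else 2 * n k := fun k => by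
        by_cases hk : k = i
        · subst hk
          simp
        · simp [hk]
      have hoddiff : ∀ k, Odd (((fun i' => (2 * n i' : ℤ)) - Pi.single i 1 : Fin d → ℤ) k)
          ↔ k = i := fun k => by
        rw [hval]
        split_ifs with hk
        · exact ⟨fun _ => hk, fun _ => ⟨n i - 1, by omega⟩⟩
        · simp [hk, parity_simps]
      have heq := hXr ((fun i' => (2 * n i' : ℤ)) - Pi.single i 1)
        (fun k => by rw [hval]; split_ifs <;> omega)
        (fun k k' hk hk' => ((hoddiff k).1 hk).trans ((hoddiff k').1 hk').symm)
        i ((hoddiff i).2 rfl)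
      have hsub : (fun i' => (2 * n i' : ℤ)) - Pi.single i 1 - Pi.single i 1
          = (fun i' => (2 * n i' : ℤ)) - Pi.single i 2 := by
        rw [sub_sub, ← Pi.single_add]
        rfl
      have hsum : (((∑ k, ((fun i' => (2 * n i' : ℤ)) - Pi.single i 1 : Fin d → ℤ) k) + 1 : ℤ) : ℂ)
          = 2 * ∑ k, (n k : ℂ) := by
        simp [Finset.sum_sub_distrib, Finset.mul_sum, Pi.single_apply]
      rw [hsub, hsum] at heq
      have hder := (hasDerivWithinAt_integral_Icc (((hr i).mul (hu₀.pow 2)).mul hcont)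
        hx₀ hx).const_mul (2 * ∑ k, (n k : ℂ))
      exact (hder.congr heq (heq x hx)).congr_deriv (by simp only [Pi.mul_apply, Pi.pow_apply])
  refine ⟨hodd, fun x hx => ?_⟩
  have hcont : ContinuousOn (fun t => (1 / (p t * u₀ t ^ 2)) *
      ∑ i, X ((fun i' => (2 * n i' : ℤ)) - Pi.single i 1) t) (Icc x₁ x₂) := by
    refine ContinuousOn.mul ?_ (continuousOn_finsetSum _ fun i _ y hy =>
      (hodd i y hy).continuousWithinAt)
    exact continuousOn_const.div (hp.mul (hu₀.pow 2)) fun y hy =>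
      mul_ne_zero (hpne y hy) (pow_ne_zero 2 (hu₀ne y hy))
  have heq := hXp (fun i => (2 * n i : ℤ)) (fun i => by positivity)
    (fun i _ hi => absurd hi (Int.not_odd_iff_even.2 (even_two_mul _))) (by rw [← Finset.mul_sum]; exact even_two_mul _)
  have hsum : (((∑ i, (2 * n i : ℤ)) + 1 : ℤ) : ℂ) = 2 * ∑ i, (n i : ℂ) + 1 := by
    simp [Finset.mul_sum]
  rw [hsum] at heq
  exact ((hasDerivWithinAt_integral_Icc hcont hx₀ hx).const_mul _).congr heq (heq x hx)


/-- **Lemma on `L(u₀ X_{2n+(1/d)𝟙})`.**  The second family of SPPS formal powers is indexed by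
multiindices `j` with all entries in `(1/d) + ℤ`.  We represent such a `j` by its integer part
vector `m ∈ ℤ^d`, i.e. `j = m + (1/d)𝟙`, writing `X m` for `X_{m + (1/d)𝟙}`; thus
`|j| = (Σ mᵢ) + 1`, the integer parts are the `mᵢ`, and `j` is admissible when at most one `mᵢ`
is odd.  The recursion reads: `X (−δᵢ) = 1/d` (starting values, paper's `X_{(1/d)𝟙−δᵢ}`);
`X m = 0` when some `mᵢ < 0` apart from the starting values; for admissible `m ≥ 0`,
`X m = |j| ∫_{x₀}^x rᵢ u₀² X (m−δᵢ)` when `|j|` is even with `mᵢ` odd in position `i`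
(i.e. `mᵢ` odd), and `X m = |j| ∫_{x₀}^x (1/(p u₀²)) Σᵢ X (m−δᵢ)` when `|j|` is odd
(i.e. `Σ mᵢ` even).  Then for every `n ∈ ℕ^d`,
`L(u₀ X_{2n+(1/d)𝟙}) = (2|n|+1)(2|n|) u₀ Σᵢ rᵢ X_{2n−2δᵢ+(1/d)𝟙}` on `[x₁, x₂]`,
where `L y = (p y′)′ + q y` (derivatives within `[x₁, x₂]`). -/
theorem Lu0X_formula
    (d : ℕ) (hd : 1 ≤ d)
    (x₁ x₂ x₀ : ℝ) (hx : x₁ < x₂) (hx₀ : x₀ ∈ Set.Icc x₁ x₂)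
    (p q u₀ : ℝ → ℂ) (r : Fin d → ℝ → ℂ)
    (hp : ContDiffOn ℝ 1 p (Set.Icc x₁ x₂))
    (hq : ContinuousOn q (Set.Icc x₁ x₂))
    (hr : ∀ i, ContinuousOn (r i) (Set.Icc x₁ x₂))
    (hpne : ∀ x ∈ Set.Icc x₁ x₂, p x ≠ 0)
    (hu₀ : ContDiffOn ℝ 2 u₀ (Set.Icc x₁ x₂))
    (hu₀ne : ∀ x ∈ Set.Icc x₁ x₂, u₀ x ≠ 0)
    (hu₀sol : ∀ x ∈ Set.Icc x₁ x₂,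
      derivWithin (fun t => p t * derivWithin u₀ (Set.Icc x₁ x₂) t) (Set.Icc x₁ x₂) x
        + q x * u₀ x = 0)
    (X : (Fin d → ℤ) → ℝ → ℂ)
    (hX0 : ∀ i : Fin d, ∀ x, X (-Pi.single i 1) x = 1 / (d : ℂ))
    (hXneg : ∀ m : Fin d → ℤ, (∃ i, m i < 0) → (∀ i, m ≠ -Pi.single i 1) →
      ∀ x, X m x = 0)
    (hXr : ∀ m : Fin d → ℤ, (∀ i, 0 ≤ m i) →
      (∀ i i', Odd (m i) → Odd (m i') → i = i') →
      ∀ i, Odd (m i) → ∀ x ∈ Set.Icc x₁ x₂,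
        X m x = (((∑ i', m i') + 1 : ℤ) : ℂ) *
          ∫ t in x₀..x, r i t * u₀ t ^ 2 * X (m - Pi.single i 1) t)
    (hXp : ∀ m : Fin d → ℤ, (∀ i, 0 ≤ m i) →
      (∀ i i', Odd (m i) → Odd (m i') → i = i') →
      Even (∑ i, m i) → ∀ x ∈ Set.Icc x₁ x₂,
        X m x = (((∑ i, m i) + 1 : ℤ) : ℂ) *
          ∫ t in x₀..x, (1 / (p t * u₀ t ^ 2)) * ∑ i, X (m - Pi.single i 1) t) :
    ∀ n : Fin d → ℕ, ∀ x ∈ Set.Icc x₁ x₂,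
      derivWithin (fun t => p t *
          derivWithin (fun s => u₀ s * X (fun i => (2 * n i : ℤ)) s) (Set.Icc x₁ x₂) t)
          (Set.Icc x₁ x₂) x
        + q x * (u₀ x * X (fun i => (2 * n i : ℤ)) x)
      = (2 * ∑ i, (n i : ℂ) + 1) * (2 * ∑ i, (n i : ℂ)) * u₀ x *
          ∑ i, r i x * X ((fun i' => (2 * n i' : ℤ)) - Pi.single i 2) x := by
  intro n x hxS
  have hS : UniqueDiffOn ℝ (Set.Icc x₁ x₂) := uniqueDiffOn_Icc hx
  obtain ⟨hY, hX⟩ := formalPower_hasDerivWithinAt hx₀ hp.continuousOn hr hpne hu₀.continuousOn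
    hu₀ne hX0 hXneg hXr hXp n
  have hpu : DifferentiableOn ℝ (fun t => p t * derivWithin u₀ (Set.Icc x₁ x₂) t)
      (Set.Icc x₁ x₂) :=
    (hp.differentiableOn one_ne_zero).mul
      ((hu₀.derivWithin hS (m := 1) (by norm_num)).differentiableOn one_ne_zero)
  have hne := hu₀ne x hxS
  generalize ∑ i, (n i : ℂ) = N at hX hY ⊢
  rw [sturmLiouville_mul_eq hS hpne hu₀ne (hu₀.differentiableOn two_ne_zero) hpu hu₀sol hX
    (fun y hy => HasDerivWithinAt.fun_sum fun i _ => hY i y hy) hxS, div_eq_iff hne,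
    Finset.mul_sum, Finset.mul_sum, Finset.sum_mul]
  refine Finset.sum_congr rfl fun i _ => ?_
  ring
end

section
/- (Part of the main SPPS theorem.) For every λ = (λ₁,…,λ_d) ∈ ℂ^d, the function u₁(x) = u₀(x) Σ_{n∈ℕ^d} (1/(2|n|)!) X̃_{2n}(x) λ₁^{n₁}⋯λ_d^{n_d} is twice continuously differentiable on [x₁, x₂] and satisfies the Sturm–Liouville equation (p u₁′)′ + q u₁ = (λ₁ r₁ + ⋯ + λ_d r_d) u₁ on [x₁, x₂]. -/
namespace SPPS

open Set MeasureTheory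

theorem summable_pow_div_factorial_sum {ι : Type*} [Fintype ι] {D : ℝ} (hD : 0 ≤ D) :
    Summable fun n : ι → ℕ => D ^ (∑ i, n i) / ((∑ i, n i).factorial : ℝ) := by
  classical
  have hprod : Summable fun n : ι → ℕ => ∏ i, D ^ n i / ((n i).factorial : ℝ) := by
    refine summable_of_sum_le (c := ∏ _i : ι, Real.exp D)
      (fun n => Finset.prod_nonneg fun i _ => by positivity) fun s => ?_
    let N : ℕ := s.sup (fun n => ∑ i, n i) + 1
    have hs : s ⊆ Fintype.piFinset fun _ : ι => Finset.range N := fun n hn => by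
      rw [Fintype.mem_piFinset]
      intro i
      have h₁ : n i ≤ ∑ i, n i := Finset.single_le_sum (fun _ _ => Nat.zero_le _)
        (Finset.mem_univ i)
      have h₂ := Finset.le_sup (f := fun n : ι → ℕ => ∑ i, n i) hn
      exact Finset.mem_range.2 (Nat.lt_succ_of_le (h₁.trans h₂))
    calc ∑ n ∈ s, ∏ i, D ^ n i / ((n i).factorial : ℝ)
        ≤ ∑ n ∈ Fintype.piFinset fun _ : ι => Finset.range N,
            ∏ i, D ^ n i / ((n i).factorial : ℝ) :=
          Finset.sum_le_sum_of_subset_of_nonneg hs fun n _ _ =>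
            Finset.prod_nonneg fun i _ => by positivity
      _ = ∏ _i : ι, ∑ k ∈ Finset.range N, D ^ k / (k.factorial : ℝ) :=
          (Finset.prod_univ_sum (fun _ : ι => Finset.range N)
            fun _ k => D ^ k / (k.factorial : ℝ)).symm
      _ ≤ ∏ _i : ι, Real.exp D :=
          Finset.prod_le_prod (fun i _ => Finset.sum_nonneg fun k _ => by positivity)
            fun i _ => Real.sum_le_exp_of_nonneg hD N
  refine hprod.of_nonneg_of_le (fun n => by positivity) fun n => ?_
  rw [Finset.prod_div_distrib, Finset.prod_pow_eq_pow_sum]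
  have h : ∏ i, (n i).factorial ≤ (∑ i, n i).factorial :=
    Nat.le_of_dvd (Nat.factorial_pos _) (Nat.prod_factorial_dvd_factorial_sum _ _)
  have h' : (∏ i, ((n i).factorial : ℝ)) ≤ ((∑ i, n i).factorial : ℝ) := by exact_mod_cast h
  gcongr

section Interval

variable {x₁ x₂ x₀ x : ℝ} {f : ℝ → ℂ}

theorem intervalIntegrable_of_continuousOn_Icc (hf : ContinuousOn f (Icc x₁ x₂))
    (hx₀ : x₀ ∈ Icc x₁ x₂) (hx : x ∈ Icc x₁ x₂) : IntervalIntegrable f volume x₀ x :=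
  (hf.mono (uIcc_subset_Icc hx₀ hx)).intervalIntegrable

theorem hasDerivWithinAt_integral_Icc (hf : ContinuousOn f (Icc x₁ x₂))
    (hx₀ : x₀ ∈ Icc x₁ x₂) (hx : x ∈ Icc x₁ x₂) :
    HasDerivWithinAt (fun y => ∫ t in x₀..y, f t) (f x) (Icc x₁ x₂) x := by
  have : Fact (x ∈ Icc x₁ x₂) := ⟨hx⟩
  exact intervalIntegral.integral_hasDerivWithinAt_right
    (intervalIntegrable_of_continuousOn_Icc hf hx₀ hx)
    (hf.stronglyMeasurableAtFilter_nhdsWithin measurableSet_Icc x) (hf x hx)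

theorem continuousOn_integral_Icc (hf : ContinuousOn f (Icc x₁ x₂)) (hx₀ : x₀ ∈ Icc x₁ x₂) :
    ContinuousOn (fun y => ∫ t in x₀..y, f t) (Icc x₁ x₂) :=
  fun _ hx => (hasDerivWithinAt_integral_Icc hf hx₀ hx).continuousWithinAt

theorem norm_integral_le_of_norm_le_pow {C : ℝ} {m : ℕ}
    (hf : ∀ t ∈ uIoc x₀ x, ‖f t‖ ≤ C * |t - x₀| ^ m) :
    ‖∫ t in x₀..x, f t‖ ≤ C * (|x - x₀| ^ (m + 1) / (m + 1)) := by
  have hint : IntegrableOn (fun t => C * |t - x₀| ^ m) (uIoc x₀ x) :=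
    (Continuous.intervalIntegrable (by fun_prop) x₀ x).def'
  rw [intervalIntegral.norm_integral_eq_norm_integral_uIoc, ← integral_pow_abs_sub_uIoc,
    ← integral_const_mul]
  exact norm_integral_le_of_norm_le hint
    ((ae_restrict_iff' measurableSet_uIoc).2 (Filter.Eventually.of_forall hf))

theorem hasSum_integral_of_norm_le {ι : Type*} [Countable ι] {F : ι → ℝ → ℂ} {β : ι → ℝ}
    (hF : ∀ n, ContinuousOn (F n) (Icc x₁ x₂)) (hβ : Summable β)
    (hbound : ∀ n, ∀ t ∈ Icc x₁ x₂, ‖F n t‖ ≤ β n)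
    (hsum : ∀ t ∈ Icc x₁ x₂, HasSum (fun n => F n t) (f t))
    (hx₀ : x₀ ∈ Icc x₁ x₂) (hx : x ∈ Icc x₁ x₂) :
    HasSum (fun n => ∫ t in x₀..x, F n t) (∫ t in x₀..x, f t) := by
  have hsub : uIoc x₀ x ⊆ Icc x₁ x₂ := uIoc_subset_uIcc.trans (uIcc_subset_Icc hx₀ hx)
  exact intervalIntegral.hasSum_integral_of_dominated_convergence (fun n _ => β n)
    (fun n => ((hF n).mono hsub).aestronglyMeasurable measurableSet_uIoc)
    (fun n => Filter.Eventually.of_forall fun t ht => hbound n t (hsub ht))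
    (Filter.Eventually.of_forall fun _ _ => hβ) intervalIntegrable_const
    (Filter.Eventually.of_forall fun t ht => hsum t (hsub ht))

end Interval

theorem exists_eq_add_single {ι : Type*} [Fintype ι] [DecidableEq ι] {n : ι → ℕ} {i : ι}
    (h : n i ≠ 0) : ∃ k : ι → ℕ, n = k + Pi.single i 1 ∧ ∑ j, n j = ∑ j, k j + 1 := by
  have hn : n = (n - Pi.single i 1) + Pi.single i 1 := by
    refine (tsub_add_cancel_of_le ?_).symm
    intro j
    by_cases hj : j = i
    · subst hj; simpa using Nat.one_le_iff_ne_zero.2 h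
    · simp [hj]
  refine ⟨_, hn, ?_⟩
  conv_lhs => rw [hn]
  simp [Finset.sum_add_distrib]

/-- The data of an iterated-integral series: coefficients `a n` and `b n i`, indexed by
multiindices, generated from `a 0 = 1` by alternately integrating against the weights
`ρ i` and `w`. -/
structure IsIteratedIntegral {ι : Type*} [Fintype ι] [DecidableEq ι] (x₁ x₂ x₀ : ℝ)
    (w : ℝ → ℂ) (ρ : ι → ℝ → ℂ) (a : (ι → ℕ) → ℝ → ℂ) (b : (ι → ℕ) → ι → ℝ → ℂ) : Prop where
  base_mem : x₀ ∈ Icc x₁ x₂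
  continuousOn_w : ContinuousOn w (Icc x₁ x₂)
  continuousOn_ρ : ∀ i, ContinuousOn (ρ i) (Icc x₁ x₂)
  a_eq : ∀ n, ∀ x ∈ Icc x₁ x₂,
    a n x = (if n = 0 then 1 else 0) + ∫ t in x₀..x, w t * ∑ i, b n i t
  b_eq_zero : ∀ n i, n i = 0 → ∀ x ∈ Icc x₁ x₂, b n i x = 0
  b_eq : ∀ n i, ∀ x ∈ Icc x₁ x₂, b (n + Pi.single i 1) i x = ∫ t in x₀..x, ρ i t * a n t

namespace IsIteratedIntegral

variable {ι : Type*} [Fintype ι] [DecidableEq ι] {x₁ x₂ x₀ : ℝ} {w : ℝ → ℂ} {ρ : ι → ℝ → ℂ}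
  {a : (ι → ℕ) → ℝ → ℂ} {b : (ι → ℕ) → ι → ℝ → ℂ}

theorem continuousOn_b_of_continuousOn_a (h : IsIteratedIntegral x₁ x₂ x₀ w ρ a b) {n : ι → ℕ}
    (ha : ∀ k, ∑ i, n i = ∑ i, k i + 1 → ContinuousOn (a k) (Icc x₁ x₂)) (i : ι) :
    ContinuousOn (b n i) (Icc x₁ x₂) := by
  by_cases hn : n i = 0
  · exact continuousOn_const.congr (h.b_eq_zero n i hn)
  · obtain ⟨k, rfl, hk⟩ := exists_eq_add_single hn
    exact (continuousOn_integral_Icc ((h.continuousOn_ρ i).mul (ha k hk)) h.base_mem).congr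
      (h.b_eq k i)

theorem continuousOn_a (h : IsIteratedIntegral x₁ x₂ x₀ w ρ a b) (n : ι → ℕ) :
    ContinuousOn (a n) (Icc x₁ x₂) := by
  induction hm : ∑ i, n i using Nat.strong_induction_on generalizing n with
  | _ m ih =>
    have hb := h.continuousOn_b_of_continuousOn_a (n := n) fun k hk => ih (∑ i, k i) (by omega) k rfl
    exact (continuousOn_const.add (continuousOn_integral_Icc
      (h.continuousOn_w.mul (continuousOn_finsetSum _ fun i _ => hb i)) h.base_mem)).congr
      (h.a_eq n)

theorem continuousOn_b (h : IsIteratedIntegral x₁ x₂ x₀ w ρ a b) (n : ι → ℕ) (i : ι) :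
    ContinuousOn (b n i) (Icc x₁ x₂) :=
  h.continuousOn_b_of_continuousOn_a (fun k _ => h.continuousOn_a k) i

variable {A R K : ℝ}

theorem norm_b_le_of_norm_a_le (h : IsIteratedIntegral x₁ x₂ x₀ w ρ a b) (hR : 0 ≤ R)
    (hρ : ∀ i, ∀ x ∈ Icc x₁ x₂, ‖ρ i x‖ ≤ R) {k : ι → ℕ} {m : ℕ} {C : ℝ} (hC : 0 ≤ C)
    (ha : ∀ x ∈ Icc x₁ x₂, ‖a k x‖ ≤ C * |x - x₀| ^ m) (i : ι) {x : ℝ}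
    (hx : x ∈ Icc x₁ x₂) :
    ‖b (k + Pi.single i 1) i x‖ ≤ R * (x₂ - x₁) * C * |x - x₀| ^ m := by
  have hx₀ := h.base_mem
  have hL : |x - x₀| ≤ x₂ - x₁ := abs_sub_le_of_le_of_le hx.1 hx.2 hx₀.1 hx₀.2
  rw [h.b_eq k i x hx]
  calc ‖∫ t in x₀..x, ρ i t * a k t‖ ≤ (R * (C * |x - x₀| ^ m)) * |x - x₀| := by
        refine intervalIntegral.norm_integral_le_of_norm_le_const fun t ht => ?_
        have htu := uIoc_subset_uIcc ht
        have htI := uIcc_subset_Icc hx₀ hx htu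
        rw [norm_mul]
        have h1 : |t - x₀| ≤ |x - x₀| := abs_sub_left_of_mem_uIcc htu
        have h2 := ha t htI
        have h3 := hρ i t htI
        have : C * |t - x₀| ^ m ≤ C * |x - x₀| ^ m := by gcongr
        exact mul_le_mul h3 (h2.trans this) (norm_nonneg _) hR
    _ ≤ (R * (C * |x - x₀| ^ m)) * (x₂ - x₁) := by gcongr
    _ = _ := by ring

theorem norm_a_le (h : IsIteratedIntegral x₁ x₂ x₀ w ρ a b) (hA : 0 ≤ A)
    (hw : ∀ x ∈ Icc x₁ x₂, ‖w x‖ ≤ A) (hR : 0 ≤ R)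
    (hρ : ∀ i, ∀ x ∈ Icc x₁ x₂, ‖ρ i x‖ ≤ R)
    (hK : K = A * (Fintype.card ι * (R * (x₂ - x₁)))) (n : ι → ℕ) :
    ∀ x ∈ Icc x₁ x₂,
      ‖a n x‖ ≤ K ^ (∑ i, n i) / ((∑ i, n i).factorial : ℝ) * |x - x₀| ^ (∑ i, n i) := by
  have hx₀ := h.base_mem
  have hL : 0 ≤ x₂ - x₁ := sub_nonneg.2 (hx₀.1.trans hx₀.2)
  have hK0 : 0 ≤ K := by rw [hK]; positivity
  induction hm : ∑ i, n i generalizing n with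
  | zero =>
    have hn : n = 0 := funext fun i => by
      have := Finset.sum_eq_zero_iff.1 hm i (Finset.mem_univ i)
      simpa using this
    subst hn
    intro x hx
    have hb : ∫ t in x₀..x, w t * ∑ i, b 0 i t = 0 := by
      refine intervalIntegral.integral_zero_ae (Filter.Eventually.of_forall fun t ht => ?_)
      have htI := uIcc_subset_Icc hx₀ hx (uIoc_subset_uIcc ht)
      rw [Finset.sum_eq_zero fun i _ => h.b_eq_zero 0 i rfl t htI, mul_zero]
    simp [h.a_eq 0 x hx, hb]
  | succ m ih =>
    intro x hx
    have hn : n ≠ 0 := by rintro rfl; simp at hm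
    rw [h.a_eq n x hx, if_neg hn, zero_add]
    have hb : ∀ i, ∀ t ∈ Icc x₁ x₂,
        ‖b n i t‖ ≤ R * (x₂ - x₁) * (K ^ m / (m.factorial : ℝ)) * |t - x₀| ^ m := by
      intro i t ht
      by_cases hni : n i = 0
      · rw [h.b_eq_zero n i hni t ht, norm_zero]; positivity
      · obtain ⟨k, rfl, hk⟩ := exists_eq_add_single hni
        exact h.norm_b_le_of_norm_a_le hR hρ (by positivity) (ih k (by omega)) i ht
    refine (norm_integral_le_of_norm_le_pow
      (C := K * (K ^ m / (m.factorial : ℝ))) (m := m) fun t ht => ?_).trans_eq ?_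
    · have htI := uIcc_subset_Icc hx₀ hx (uIoc_subset_uIcc ht)
      rw [norm_mul]
      have hs : ‖∑ i, b n i t‖ ≤
          Fintype.card ι * (R * (x₂ - x₁) * (K ^ m / (m.factorial : ℝ)) * |t - x₀| ^ m) := by
        refine (norm_sum_le_of_le _ fun i _ => hb i t htI).trans_eq ?_
        simp
      calc ‖w t‖ * ‖∑ i, b n i t‖ ≤ A * _ := mul_le_mul (hw t htI) hs (norm_nonneg _) hA
        _ = _ := by nth_rw 2 [hK]; ring
    · rw [Nat.factorial_succ]
      push_cast
      field_simp
      ring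

theorem exists_summable_bound (h : IsIteratedIntegral x₁ x₂ x₀ w ρ a b) :
    ∃ β : (ι → ℕ) → ℝ, Summable β ∧ (∀ n, ∀ x ∈ Icc x₁ x₂, ‖a n x‖ ≤ β n) ∧
      ∀ n i, ∀ x ∈ Icc x₁ x₂, ‖b n i x‖ ≤ β n := by
  have hx₀ := h.base_mem
  obtain ⟨A, hA⟩ := isCompact_Icc.exists_bound_of_continuousOn h.continuousOn_w
  have hA0 : 0 ≤ A := (norm_nonneg _).trans (hA x₀ hx₀)
  obtain ⟨R, hR⟩ := isCompact_Icc.exists_bound_of_continuousOn (continuousOn_pi.2 h.continuousOn_ρ)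
  have hR0 : 0 ≤ R := (norm_nonneg _).trans (hR x₀ hx₀)
  have hρ : ∀ i, ∀ x ∈ Icc x₁ x₂, ‖ρ i x‖ ≤ R := fun i x hx =>
    (norm_le_pi_norm (fun i => ρ i x) i).trans (hR x hx)
  obtain ⟨L, hL⟩ : ∃ L, L = x₂ - x₁ := ⟨_, rfl⟩
  have hL0 : 0 ≤ L := hL ▸ sub_nonneg.2 (hx₀.1.trans hx₀.2)
  obtain ⟨K, hK⟩ : ∃ K, K = A * (Fintype.card ι * (R * (x₂ - x₁))) := ⟨_, rfl⟩
  have hK0 : 0 ≤ K := by rw [hK, ← hL]; positivity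
  have ha := h.norm_a_le hA0 hA hR0 hρ hK
  have hdist : ∀ x ∈ Icc x₁ x₂, |x - x₀| ≤ L := fun x hx =>
    hL ▸ abs_sub_le_of_le_of_le hx.1 hx.2 hx₀.1 hx₀.2
  obtain ⟨D, hD⟩ : ∃ D, D = 2 * (K * L + 1) := ⟨_, rfl⟩
  have hKL : 0 ≤ K * L := by positivity
  have hD0 : 0 ≤ D := by rw [hD]; positivity
  refine ⟨fun n => (1 + R * L) * (D ^ (∑ i, n i) / ((∑ i, n i).factorial : ℝ)),
    (summable_pow_div_factorial_sum hD0).mul_left _, fun n x hx => ?_, fun n i x hx => ?_⟩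
  · calc ‖a n x‖ ≤ K ^ (∑ i, n i) / ((∑ i, n i).factorial : ℝ) * |x - x₀| ^ (∑ i, n i) := ha n x hx
      _ ≤ K ^ (∑ i, n i) / ((∑ i, n i).factorial : ℝ) * L ^ (∑ i, n i) := by
        gcongr; exact hdist x hx
      _ = 1 * ((K * L) ^ (∑ i, n i) / ((∑ i, n i).factorial : ℝ)) := by rw [mul_pow]; ring
      _ ≤ (1 + R * L) * (D ^ (∑ i, n i) / ((∑ i, n i).factorial : ℝ)) := by
        gcongr
        · linarith [mul_nonneg hR0 hL0]
        · rw [hD]; linarith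
  · by_cases hni : n i = 0
    · rw [h.b_eq_zero n i hni x hx, norm_zero]; positivity
    · obtain ⟨k, rfl, hk⟩ := exists_eq_add_single hni
      beta_reduce
      rw [hk]
      generalize hm : ∑ i, k i = m
      have hak := ha k
      rw [hm] at hak
      have hpow : ((m : ℝ) + 1) * (K * L) ^ m ≤ D ^ (m + 1) := by
        have h2 : ((m : ℝ) + 1) ≤ 2 ^ (m + 1) := by
          exact_mod_cast (Nat.lt_two_pow_self (n := m + 1)).le
        calc ((m : ℝ) + 1) * (K * L) ^ m ≤ 2 ^ (m + 1) * (K * L + 1) ^ (m + 1) := by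
              refine mul_le_mul h2 ?_ (by positivity) (by positivity)
              calc (K * L) ^ m ≤ (K * L + 1) ^ m := by gcongr; linarith
                _ ≤ (K * L + 1) ^ (m + 1) := pow_le_pow_right₀ (by linarith) (Nat.le_succ m)
          _ = D ^ (m + 1) := by rw [hD, mul_pow]
      calc ‖b (k + Pi.single i 1) i x‖
          ≤ R * (x₂ - x₁) * (K ^ m / (m.factorial : ℝ)) * |x - x₀| ^ m :=
            h.norm_b_le_of_norm_a_le hR0 hρ (by positivity) hak i hx
        _ ≤ R * L * (K ^ m / (m.factorial : ℝ)) * L ^ m := by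
            rw [← hL]; gcongr; exact hdist x hx
        _ = R * L * (((m : ℝ) + 1) * (K * L) ^ m / ((m + 1).factorial : ℝ)) := by
            rw [Nat.factorial_succ, mul_pow]; push_cast; field_simp
        _ ≤ (1 + R * L) * (D ^ (m + 1) / ((m + 1).factorial : ℝ)) := by
            gcongr; linarith

theorem exists_hasDerivWithinAt (h : IsIteratedIntegral x₁ x₂ x₀ w ρ a b) :
    ∃ T : ℝ → ℂ, ∀ x ∈ Icc x₁ x₂,
      HasDerivWithinAt (fun y => ∑' n, a n y) (w x * T x) (Icc x₁ x₂) x ∧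
      HasDerivWithinAt T ((∑ i, ρ i x) * ∑' n, a n x) (Icc x₁ x₂) x := by
  have hx₀ := h.base_mem
  obtain ⟨β, hβ, ha, hb⟩ := h.exists_summable_bound
  have hS : ContinuousOn (fun y => ∑' n, a n y) (Icc x₁ x₂) :=
    continuousOn_tsum h.continuousOn_a hβ ha
  have hSsum : ∀ x ∈ Icc x₁ x₂, HasSum (fun n => a n x) (∑' n, a n x) := fun x hx =>
    (Summable.of_norm_bounded hβ fun n => ha n x hx).hasSum
  have hρS : ∀ i, ContinuousOn (fun t => ρ i t * ∑' n, a n t) (Icc x₁ x₂) := fun i =>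
    (h.continuousOn_ρ i).mul hS
  have hbsum : ∀ i, ∀ x ∈ Icc x₁ x₂,
      HasSum (fun n => b n i x) (∫ t in x₀..x, ρ i t * ∑' n, a n t) := by
    intro i x hx
    obtain ⟨R, hR⟩ := isCompact_Icc.exists_bound_of_continuousOn (h.continuousOn_ρ i)
    have hint := hasSum_integral_of_norm_le (F := fun n t => ρ i t * a n t) (β := fun n => R * β n)
      (fun n => (h.continuousOn_ρ i).mul (h.continuousOn_a n)) (hβ.mul_left R)
      (fun n t ht => by
        rw [norm_mul]
        exact mul_le_mul (hR t ht) (ha n t ht) (norm_nonneg _) ((norm_nonneg _).trans (hR t ht)))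
      (fun t ht => (hSsum t ht).mul_left (ρ i t)) hx₀ hx
    refine (Function.Injective.hasSum_iff
      (g := fun n : ι → ℕ => n + Pi.single i 1) (add_left_injective _) fun n hn => ?_).1 ?_
    · refine h.b_eq_zero n i ?_ x hx
      by_contra hni
      obtain ⟨k, hk, -⟩ := exists_eq_add_single hni
      exact hn ⟨k, hk.symm⟩
    · exact hint.congr_fun fun n => h.b_eq n i x hx
  let T : ℝ → ℂ := fun y => ∑ i, ∫ t in x₀..y, ρ i t * ∑' n, a n t
  have hT : ∀ x ∈ Icc x₁ x₂,
      HasDerivWithinAt T ((∑ i, ρ i x) * ∑' n, a n x) (Icc x₁ x₂) x := by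
    intro x hx
    rw [Finset.sum_mul]
    exact HasDerivWithinAt.fun_sum fun i _ => hasDerivWithinAt_integral_Icc (hρS i) hx₀ hx
  have hwT : ContinuousOn (fun t => w t * T t) (Icc x₁ x₂) :=
    h.continuousOn_w.mul fun x hx => (hT x hx).continuousWithinAt
  have hSeq : ∀ x ∈ Icc x₁ x₂, ∑' n, a n x = 1 + ∫ t in x₀..x, w t * T t := by
    intro x hx
    obtain ⟨A, hA⟩ := isCompact_Icc.exists_bound_of_continuousOn h.continuousOn_w
    have hint := hasSum_integral_of_norm_le (F := fun n t => w t * ∑ i, b n i t)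
      (f := fun t => w t * T t) (β := fun n => A * (Fintype.card ι * β n))
      (fun n => h.continuousOn_w.mul (continuousOn_finsetSum _ fun i _ => h.continuousOn_b n i))
      ((hβ.mul_left _).mul_left A)
      (fun n t ht => by
        rw [norm_mul]
        refine mul_le_mul (hA t ht) ?_ (norm_nonneg _) ((norm_nonneg _).trans (hA t ht))
        refine (norm_sum_le_of_le _ fun i _ => hb n i t ht).trans_eq ?_
        simp)
      (fun t ht => (hasSum_sum fun i _ => hbsum i t ht).mul_left (w t)) hx₀ hx
    have hone : HasSum (fun n : ι → ℕ => if n = 0 then (1 : ℂ) else 0) 1 :=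
      hasSum_ite_eq 0 1
    exact ((hone.add hint).congr_fun fun n => h.a_eq n x hx).tsum_eq
  refine ⟨T, fun x hx => ⟨?_, hT x hx⟩⟩
  exact ((hasDerivWithinAt_integral_Icc hwT hx₀ hx).const_add 1).congr hSeq (hSeq x hx)

end IsIteratedIntegral

section FormalPowers

variable {d : ℕ} {x₁ x₂ x₀ : ℝ} {p u₀ : ℝ → ℂ} {r : Fin d → ℝ → ℂ} {Xt : (Fin d → ℤ) → ℝ → ℂ}

theorem eq_of_odd_two_mul_sub_single {n : Fin d → ℤ} {i k : Fin d}
    (h : Odd (((fun j => 2 * n j) - Pi.single i 1 : Fin d → ℤ) k)) : k = i := by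
  by_contra hk
  have h' : Odd (2 * n k) := by simpa [hk] using h
  exact Int.not_odd_iff_even.2 (even_two_mul _) h'

theorem isIteratedIntegral_formalPowers (hx₀ : x₀ ∈ Icc x₁ x₂)
    (hp : ContinuousOn p (Icc x₁ x₂)) (hr : ∀ i, ContinuousOn (r i) (Icc x₁ x₂))
    (hpne : ∀ x ∈ Icc x₁ x₂, p x ≠ 0) (hu₀ : ContinuousOn u₀ (Icc x₁ x₂))
    (hu₀ne : ∀ x ∈ Icc x₁ x₂, u₀ x ≠ 0)
    (hXt0 : ∀ x, Xt 0 x = 1)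
    (hXtneg : ∀ j : Fin d → ℤ, (∃ i, j i < 0) → ∀ x, Xt j x = 0)
    (hXtodd : ∀ j : Fin d → ℤ, (∀ i, 0 ≤ j i) →
      (∀ i i', Odd (j i) → Odd (j i') → i = i') →
      ∀ i, Odd (j i) → ∀ x ∈ Icc x₁ x₂,
        Xt j x = (((∑ i', j i') : ℤ) : ℂ) *
          ∫ t in x₀..x, r i t * u₀ t ^ 2 * Xt (j - Pi.single i 1) t)
    (hXteven : ∀ j : Fin d → ℤ, (∀ i, 0 ≤ j i) →
      (∀ i i', Odd (j i) → Odd (j i') → i = i') →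
      Even (∑ i, j i) → j ≠ 0 → ∀ x ∈ Icc x₁ x₂,
        Xt j x = (((∑ i, j i) : ℤ) : ℂ) *
          ∫ t in x₀..x, (1 / (p t * u₀ t ^ 2)) * ∑ i, Xt (j - Pi.single i 1) t)
    (lam : Fin d → ℂ) :
    IsIteratedIntegral x₁ x₂ x₀ (fun t => 1 / (p t * u₀ t ^ 2))
      (fun i t => lam i * r i t * u₀ t ^ 2)
      (fun n x => (1 / (Nat.factorial (2 * ∑ i, n i) : ℂ)) *
        Xt (fun i => (2 * n i : ℤ)) x * ∏ i, lam i ^ n i)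
      (fun n i x => (1 / (Nat.factorial (2 * ∑ i, n i - 1) : ℂ)) *
        Xt ((fun i => (2 * n i : ℤ)) - Pi.single i 1) x * ∏ i, lam i ^ n i) where
  base_mem := hx₀
  continuousOn_w := continuousOn_const.div (hp.mul (hu₀.pow 2))
    fun x hx => mul_ne_zero (hpne x hx) (pow_ne_zero 2 (hu₀ne x hx))
  continuousOn_ρ i := (continuousOn_const.mul (hr i)).mul (hu₀.pow 2)
  b_eq_zero n i hn x _ := by
    rw [hXtneg _ ⟨i, by simp [hn]⟩]
    simp
  a_eq n x hx := by
    by_cases hn : n = 0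
    · subst hn
      have h0 : (fun i : Fin d => (2 * ((0 : Fin d → ℕ) i) : ℤ)) = 0 := by ext; simp
      have hneg : ∀ (i : Fin d) t, Xt (0 - Pi.single i 1) t = 0 := fun i t =>
        hXtneg _ ⟨i, by simp⟩ t
      simp only [h0, hXt0, hneg]
      simp
    · obtain ⟨i, hi⟩ := Function.ne_iff.1 hn
      obtain ⟨m, hm⟩ : ∃ m, 2 * ∑ i, n i = m + 1 := by
        refine Nat.exists_eq_succ_of_ne_zero ?_
        have : n i ≤ ∑ i, n i := Finset.single_le_sum (fun _ _ => Nat.zero_le _)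
          (Finset.mem_univ i)
        have : n i ≠ 0 := hi
        omega
      have hsum : ∑ i, (2 * n i : ℤ) = ((m + 1 : ℕ) : ℤ) := by
        rw [← Finset.mul_sum, ← hm]; push_cast; rfl
      have hX := hXteven (fun i => (2 * n i : ℤ)) (fun i => by positivity)
        (fun i i' hodd => absurd hodd (by simp))
        (by rw [← Finset.mul_sum]; exact even_two_mul _)
        (fun h0 => hi (by have := congrFun h0 i; simpa using this)) x hx
      rw [hsum] at hX
      rw [if_neg hn, zero_add, hX, hm, Nat.add_sub_cancel, Nat.factorial_succ]
      simp only [← Finset.sum_mul, ← Finset.mul_sum]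
      have hint : ∀ t, 1 / (p t * u₀ t ^ 2) * (1 / (m.factorial : ℂ) *
          ∑ i, Xt ((fun i => (2 * n i : ℤ)) - Pi.single i 1) t * ∏ i, lam i ^ n i) =
          (1 / (m.factorial : ℂ) * ∏ i, lam i ^ n i) * (1 / (p t * u₀ t ^ 2) *
            ∑ i, Xt ((fun i => (2 * n i : ℤ)) - Pi.single i 1) t) := fun t => by
        rw [← Finset.sum_mul]; ring
      have hm0 : (m.factorial : ℂ) ≠ 0 := Nat.cast_ne_zero.2 (Nat.factorial_ne_zero m)
      have hm1 : (m : ℂ) + 1 ≠ 0 := Nat.cast_add_one_ne_zero m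
      simp only [mul_assoc, Finset.sum_mul] at hint ⊢
      simp only [hint, intervalIntegral.integral_const_mul]
      push_cast
      field_simp
  b_eq n i x hx := by
    have hj : ((fun k => (2 * ((n + Pi.single i 1 : Fin d → ℕ) k) : ℤ)) - Pi.single i 1) -
        Pi.single i 1 = fun k => (2 * n k : ℤ) := by
      ext k
      by_cases hk : k = i
      · subst hk; simp; ring
      · simp [hk]
    have hsum : ∑ k, ((fun k => (2 * ((n + Pi.single i 1 : Fin d → ℕ) k) : ℤ)) -
        Pi.single i 1 : Fin d → ℤ) k = ((2 * ∑ k, n k + 1 : ℕ) : ℤ) := by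
      simp only [Pi.sub_apply, Finset.sum_sub_distrib, ← Finset.mul_sum, ← Nat.cast_sum,
        Pi.add_apply, Finset.sum_add_distrib, Finset.sum_pi_single', Finset.mem_univ, if_true]
      push_cast
      ring
    have hprod : ∏ k, lam k ^ (n + Pi.single i 1 : Fin d → ℕ) k = lam i * ∏ k, lam k ^ n k := by
      simp only [Pi.add_apply, pow_add, Finset.prod_mul_distrib]
      rw [mul_comm, Finset.prod_eq_single i (fun k _ hk => by simp [hk]) (by simp)]
      simp
    have hdeg : 2 * ∑ k, (n + Pi.single i 1 : Fin d → ℕ) k - 1 = 2 * ∑ k, n k + 1 := by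
      simp only [Pi.add_apply, Finset.sum_add_distrib, Finset.sum_pi_single', Finset.mem_univ,
        if_true]
      omega
    have hX := hXtodd ((fun k => (2 * ((n + Pi.single i 1 : Fin d → ℕ) k) : ℤ)) - Pi.single i 1)
      (fun k => by
        by_cases hk : k = i
        · subst hk; simp; omega
        · simp [hk])
      (fun k k' hk hk' =>
        (eq_of_odd_two_mul_sub_single hk).trans (eq_of_odd_two_mul_sub_single hk').symm)
      i (by simp) x hx
    rw [hsum, hj] at hX
    rw [hX, hprod, hdeg, Nat.factorial_succ]
    have hm0 : ((2 * ∑ k, n k).factorial : ℂ) ≠ 0 := Nat.cast_ne_zero.2 (Nat.factorial_ne_zero _)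
    have hm1 : 2 * (∑ k, (n k : ℂ)) + 1 ≠ 0 := by
      have := Nat.cast_add_one_ne_zero (R := ℂ) (2 * ∑ k, n k)
      push_cast at this
      exact this
    have hint : ∀ t, lam i * r i t * u₀ t ^ 2 * (1 / ((2 * ∑ k, n k).factorial : ℂ) *
        Xt (fun k => (2 * n k : ℤ)) t * ∏ k, lam k ^ n k) =
        (1 / ((2 * ∑ k, n k).factorial : ℂ) * (lam i * ∏ k, lam k ^ n k)) *
          (r i t * u₀ t ^ 2 * Xt (fun k => (2 * n k : ℤ)) t) := fun t => by ring
    simp only [hint, intervalIntegral.integral_const_mul]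
    push_cast
    field_simp

end FormalPowers

theorem contDiffOn_one_of_hasDerivWithinAt {s : Set ℝ} (hs : UniqueDiffOn ℝ s) {f f' : ℝ → ℂ}
    (hf : ∀ x ∈ s, HasDerivWithinAt f (f' x) s x) (hf' : ContinuousOn f' s) :
    ContDiffOn ℝ 1 f s :=
  (contDiffOn_one_iff_derivWithin hs).2 ⟨fun x hx => (hf x hx).differentiableWithinAt,
    hf'.congr fun x hx => (hf x hx).derivWithin (hs x hx)⟩

/-- If `u₀` is a nonvanishing solution of `(p u₀′)′ + q u₀ = 0`, and `S′ = T / (p u₀²)`,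
`T′ = g u₀² S`, then `u₀ S` solves `(p u′)′ + q u = g u`. -/
theorem sturmLiouville_mul {s : Set ℝ} (hs : UniqueDiffOn ℝ s) {p q u₀ g S T : ℝ → ℂ}
    (hp : ContDiffOn ℝ 1 p s) (hg : ContinuousOn g s) (hpne : ∀ x ∈ s, p x ≠ 0)
    (hu₀ : ContDiffOn ℝ 2 u₀ s) (hu₀ne : ∀ x ∈ s, u₀ x ≠ 0)
    (hu₀sol : ∀ x ∈ s, derivWithin (fun t => p t * derivWithin u₀ s t) s x + q x * u₀ x = 0)
    (hS : ∀ x ∈ s, HasDerivWithinAt S (1 / (p x * u₀ x ^ 2) * T x) s x)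
    (hT : ∀ x ∈ s, HasDerivWithinAt T (g x * u₀ x ^ 2 * S x) s x) :
    ContDiffOn ℝ 2 (fun x => u₀ x * S x) s ∧
    ∀ x ∈ s, derivWithin (fun t => p t * derivWithin (fun x => u₀ x * S x) s t) s x
      + q x * (u₀ x * S x) = g x * (u₀ x * S x) := by
  have hu₀' : ContDiffOn ℝ 1 (derivWithin u₀ s) s := by
    have h := hu₀
    rw [show (2 : WithTop ℕ∞) = 1 + 1 by norm_num, contDiffOn_succ_iff_derivWithin hs] at h
    exact h.2.2
  have hu₀1 : ContDiffOn ℝ 1 u₀ s := hu₀.of_le (by norm_num)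
  have hdu₀ : ∀ x ∈ s, HasDerivWithinAt u₀ (derivWithin u₀ s x) s x := fun x hx =>
    (hu₀1.differentiableOn (by norm_num) x hx).hasDerivWithinAt
  have hT1 : ContDiffOn ℝ 1 T s := contDiffOn_one_of_hasDerivWithinAt hs hT
    ((hg.mul (hu₀.continuousOn.pow 2)).mul fun x hx => (hS x hx).continuousWithinAt)
  have hS1 : ContDiffOn ℝ 1 S s := contDiffOn_one_of_hasDerivWithinAt hs hS
    ((continuousOn_const.div (hp.continuousOn.mul (hu₀.continuousOn.pow 2))
      fun x hx => mul_ne_zero (hpne x hx) (pow_ne_zero 2 (hu₀ne x hx))).mul hT1.continuousOn)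
  have hdu : ∀ x ∈ s, HasDerivWithinAt (fun x => u₀ x * S x)
      (derivWithin u₀ s x * S x + T x / (p x * u₀ x)) s x := fun x hx => by
    refine ((hdu₀ x hx).mul (hS x hx)).congr_deriv ?_
    have h1 := hpne x hx
    have h2 := hu₀ne x hx
    field_simp
  have hdu' : ∀ x ∈ s, derivWithin (fun x => u₀ x * S x) s x =
      derivWithin u₀ s x * S x + T x / (p x * u₀ x) := fun x hx =>
    (hdu x hx).derivWithin (hs x hx)
  constructor
  · rw [show (2 : WithTop ℕ∞) = 1 + 1 by norm_num, contDiffOn_succ_iff_derivWithin hs]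
    refine ⟨fun x hx => (hdu x hx).differentiableWithinAt, by simp, ?_⟩
    simp only [div_eq_mul_inv] at hdu'
    exact ((hu₀'.mul hS1).add (hT1.mul ((hp.mul hu₀1).inv
      fun x hx => mul_ne_zero (hpne x hx) (hu₀ne x hx)))).congr hdu'
  · intro x hx
    have hpx := hpne x hx
    have hux := hu₀ne x hx
    have hflux : ∀ t ∈ s, p t * derivWithin (fun x => u₀ x * S x) s t =
        (p t * derivWithin u₀ s t) * S t + T t / u₀ t := fun t ht => by
      rw [hdu' t ht]
      have h1 := hpne t ht
      have h2 := hu₀ne t ht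
      field_simp
    have hpu : HasDerivWithinAt (fun t => p t * derivWithin u₀ s t) (-(q x * u₀ x)) s x := by
      rw [← eq_neg_of_add_eq_zero_left (hu₀sol x hx)]
      exact ((hp.mul hu₀').differentiableOn (by norm_num) x hx).hasDerivWithinAt
    have hd := ((hpu.mul (hS x hx)).add ((hT x hx).div (hdu₀ x hx) hux)).congr hflux (hflux x hx)
    rw [hd.derivWithin (hs x hx)]
    field_simp
    ring

end SPPS


/-- **Main SPPS theorem, first solution.**  With the SPPS formal powers `X̃_j` (here `Xt j`)
defined by the recursion in the hypotheses, for every `λ ∈ ℂ^d` the function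
`u₁(x) = u₀(x) Σ_{n∈ℕ^d} (1/(2|n|)!) X̃_{2n}(x) λ₁^{n₁}⋯λ_d^{n_d}`
is twice continuously differentiable on `[x₁, x₂]` and satisfies
`(p u₁′)′ + q u₁ = (λ₁ r₁ + ⋯ + λ_d r_d) u₁` there (derivatives within `[x₁, x₂]`). -/
theorem SPPS_first_solution
    (d : ℕ) (hd : 1 ≤ d)
    (x₁ x₂ x₀ : ℝ) (hx : x₁ < x₂) (hx₀ : x₀ ∈ Set.Icc x₁ x₂)
    (p q u₀ : ℝ → ℂ) (r : Fin d → ℝ → ℂ)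
    (hp : ContDiffOn ℝ 1 p (Set.Icc x₁ x₂))
    (hq : ContinuousOn q (Set.Icc x₁ x₂))
    (hr : ∀ i, ContinuousOn (r i) (Set.Icc x₁ x₂))
    (hpne : ∀ x ∈ Set.Icc x₁ x₂, p x ≠ 0)
    (hu₀ : ContDiffOn ℝ 2 u₀ (Set.Icc x₁ x₂))
    (hu₀ne : ∀ x ∈ Set.Icc x₁ x₂, u₀ x ≠ 0)
    (hu₀sol : ∀ x ∈ Set.Icc x₁ x₂,
      derivWithin (fun t => p t * derivWithin u₀ (Set.Icc x₁ x₂) t) (Set.Icc x₁ x₂) x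
        + q x * u₀ x = 0)
    (Xt : (Fin d → ℤ) → ℝ → ℂ)
    (hXt0 : ∀ x, Xt 0 x = 1)
    (hXtneg : ∀ j : Fin d → ℤ, (∃ i, j i < 0) → ∀ x, Xt j x = 0)
    (hXtodd : ∀ j : Fin d → ℤ, (∀ i, 0 ≤ j i) →
      (∀ i i', Odd (j i) → Odd (j i') → i = i') →
      ∀ i, Odd (j i) → ∀ x ∈ Set.Icc x₁ x₂,
        Xt j x = (((∑ i', j i') : ℤ) : ℂ) *
          ∫ t in x₀..x, r i t * u₀ t ^ 2 * Xt (j - Pi.single i 1) t)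
    (hXteven : ∀ j : Fin d → ℤ, (∀ i, 0 ≤ j i) →
      (∀ i i', Odd (j i) → Odd (j i') → i = i') →
      Even (∑ i, j i) → j ≠ 0 → ∀ x ∈ Set.Icc x₁ x₂,
        Xt j x = (((∑ i, j i) : ℤ) : ℂ) *
          ∫ t in x₀..x, (1 / (p t * u₀ t ^ 2)) * ∑ i, Xt (j - Pi.single i 1) t)
    (lam : Fin d → ℂ)
    (u₁ : ℝ → ℂ)
    (hu₁def : ∀ x, u₁ x = u₀ x * ∑' n : Fin d → ℕ,
      (1 / (Nat.factorial (2 * ∑ i, n i) : ℂ)) *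
        Xt (fun i => (2 * n i : ℤ)) x * ∏ i, lam i ^ n i) :
    ContDiffOn ℝ 2 u₁ (Set.Icc x₁ x₂) ∧
    ∀ x ∈ Set.Icc x₁ x₂,
      derivWithin (fun t => p t * derivWithin u₁ (Set.Icc x₁ x₂) t) (Set.Icc x₁ x₂) x
          + q x * u₁ x
        = (∑ i, lam i * r i x) * u₁ x := by
  have hI := uniqueDiffOn_Icc hx
  obtain ⟨T, hT⟩ := (SPPS.isIteratedIntegral_formalPowers hx₀ hp.continuousOn hr hpne
    hu₀.continuousOn hu₀ne hXt0 hXtneg hXtodd hXteven lam).exists_hasDerivWithinAt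
  obtain rfl : u₁ = _ := funext hu₁def
  refine SPPS.sturmLiouville_mul hI (q := q) (g := fun x => ∑ i, lam i * r i x) (T := T) hp
    (continuousOn_finsetSum _ fun i _ => continuousOn_const.mul (hr i)) hpne hu₀ hu₀ne hu₀sol
    (fun x hx => (hT x hx).1) fun x hx => ?_
  have h := (hT x hx).2
  rwa [← Finset.sum_mul] at h
end

section
/- (Linear independence in the main SPPS theorem.) For every λ = (λ₁,…,λ_d) ∈ ℂ^d, the functions u₁ and u₂ are linearly independent over ℂ: if c₁, c₂ ∈ ℂ satisfy c₁ u₁(x) + c₂ u₂(x) = 0 for all x ∈ [x₁, x₂], then c₁ = c₂ = 0. -/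
/-- The multivariate geometric series with ratio `1 / 2` converges. -/
lemma summable_half_pow_sum (d : ℕ) :
    Summable fun n : Fin d → ℕ => ((1 : ℝ) / 2) ^ ∑ i, n i := by
  induction d with
  | zero => exact Summable.of_finite
  | succ d ih =>
    rw [← (Fin.consEquiv fun _ : Fin (d + 1) => ℕ).summable_iff]
    refine (summable_geometric_two.mul_of_nonneg ih (fun _ => by positivity)
      (fun _ => by positivity)).congr fun n => ?_
    simp [Fin.consEquiv, Fin.sum_univ_succ, pow_add]

/-- Growth estimate for the even-index formal powers of the second family. -/
lemma norm_formalPower_le {d : ℕ} (hd : 1 ≤ d) {x₁ x₂ x₀ M : ℝ} (hx₀ : x₀ ∈ Set.Icc x₁ x₂)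
    {w : ℝ → ℂ} {s : Fin d → ℝ → ℂ}
    (hw : ∀ x ∈ Set.Icc x₁ x₂, ‖w x‖ ≤ M) (hs : ∀ i, ∀ x ∈ Set.Icc x₁ x₂, ‖s i x‖ ≤ M)
    {X : (Fin d → ℤ) → ℝ → ℂ}
    (hX0 : ∀ i : Fin d, ∀ x, X (-Pi.single i 1) x = 1 / (d : ℂ))
    (hXneg : ∀ m : Fin d → ℤ, (∃ i, m i < 0) → (∀ i, m ≠ -Pi.single i 1) →
      ∀ x, X m x = 0)
    (hXr : ∀ m : Fin d → ℤ, (∀ i, 0 ≤ m i) →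
      (∀ i i', Odd (m i) → Odd (m i') → i = i') →
      ∀ i, Odd (m i) → ∀ x ∈ Set.Icc x₁ x₂,
        X m x = (((∑ i', m i') + 1 : ℤ) : ℂ) * ∫ t in x₀..x, s i t * X (m - Pi.single i 1) t)
    (hXp : ∀ m : Fin d → ℤ, (∀ i, 0 ≤ m i) →
      (∀ i i', Odd (m i) → Odd (m i') → i = i') →
      Even (∑ i, m i) → ∀ x ∈ Set.Icc x₁ x₂,
        X m x = (((∑ i, m i) + 1 : ℤ) : ℂ) * ∫ t in x₀..x, w t * ∑ i, X (m - Pi.single i 1) t)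
    (N : ℕ) : ∀ n : Fin d → ℕ, ∑ i, n i = N → ∀ x ∈ Set.Icc x₁ x₂,
      ‖X (fun i => (2 * n i : ℤ)) x‖ ≤
        (2 * N + 1).factorial * (M * |x - x₀| * (d * M ^ 2 * |x - x₀| ^ 2) ^ N) := by
  have hM : 0 ≤ M := (norm_nonneg _).trans (hw x₀ hx₀)
  have hsub : ∀ x ∈ Set.Icc x₁ x₂, ∀ t ∈ Set.uIoc x₀ x,
      t ∈ Set.Icc x₁ x₂ ∧ |t - x₀| ≤ |x - x₀| := fun x hx t ht =>
    ⟨Set.uIcc_subset_Icc hx₀ hx (Set.uIoc_subset_uIcc ht),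
      Set.abs_sub_left_of_mem_uIcc (Set.uIoc_subset_uIcc ht)⟩
  have hadm : ∀ n : Fin d → ℕ, ∀ i i' : Fin d,
      Odd ((fun i => (2 * n i : ℤ)) i) → Odd ((fun i => (2 * n i : ℤ)) i') → i = i' :=
    fun n i _ h => absurd h (by simp)
  induction N with
  | zero =>
    intro n hn x hx
    obtain rfl : n = 0 := by
      funext i
      exact (Finset.sum_eq_zero_iff.mp hn) i (Finset.mem_univ i)
    have hd0 : (d : ℂ) ≠ 0 := by exact_mod_cast (by omega : d ≠ 0)
    rw [hXp _ (by simp) (hadm 0) (by simp) x hx]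
    have hint : ‖∫ t in x₀..x, w t *
        ∑ i, X ((fun i => (2 * (0 : Fin d → ℕ) i : ℤ)) - Pi.single i 1) t‖ ≤ M * |x - x₀| := by
      refine intervalIntegral.norm_integral_le_of_norm_le_const fun t ht => ?_
      have hz : (fun i => (2 * (0 : Fin d → ℕ) i : ℤ)) = 0 := by ext; simp
      simp only [hz, zero_sub, hX0]
      simpa [hd0] using hw t (hsub x hx t ht).1
    simpa using hint
  | succ N ih =>
    intro n hn x hx
    have hnz : (∑ i, (n i : ℤ)) = N + 1 := by exact_mod_cast hn
    set h := |x - x₀|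
    have hstep : ∀ i, ∀ t ∈ Set.Icc x₁ x₂, |t - x₀| ≤ h →
        ‖X ((fun i => (2 * n i : ℤ)) - Pi.single i 1) t‖ ≤
        (2 * N + 2) * ((2 * N + 1).factorial * (M * h * (d * M ^ 2 * h ^ 2) ^ N)) * M * h := by
      intro i t ht hth
      rcases Nat.eq_zero_or_pos (n i) with hi | hi
      · rw [hXneg _ ⟨i, by simp [hi]⟩]
        · simp only [norm_zero]; positivity
        · intro k hk
          have h1 := congrArg (fun f : Fin d → ℤ => ∑ j, f j) hk
          simp only [Pi.sub_apply, Pi.neg_apply, Finset.sum_sub_distrib, Finset.sum_neg_distrib,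
            Finset.sum_pi_single', Finset.mem_univ, if_true, ← Finset.mul_sum, hnz] at h1
          simp at h1
          omega
      · have hodd : Odd (((fun i => (2 * n i : ℤ)) - Pi.single i 1 : Fin d → ℤ) i) := by
          simp
        have hoddeq : ∀ k, Odd (((fun i => (2 * n i : ℤ)) - Pi.single i 1 : Fin d → ℤ) k) →
            k = i := by
          intro k hk
          by_contra hne
          exact absurd hk (by simp [Pi.single_eq_of_ne hne])
        have hnn : ∀ k, 0 ≤ ((fun i => (2 * n i : ℤ)) - Pi.single i 1 : Fin d → ℤ) k := by
          intro k
          by_cases hk : k = i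
          · subst hk; simp; omega
          · simp [Pi.single_eq_of_ne hk]
        rw [hXr _ hnn (fun a b ha hb => (hoddeq a ha).trans (hoddeq b hb).symm) i hodd t ht]
        have hsum : (∑ k, ((fun i => (2 * n i : ℤ)) - Pi.single i 1 : Fin d → ℤ) k) + 1
            = 2 * N + 2 := by
          simp [Finset.sum_sub_distrib, ← Finset.mul_sum, hnz]; ring
        have hpred : ((fun i => (2 * n i : ℤ)) - Pi.single i 1 - Pi.single i 1 : Fin d → ℤ)
            = fun k => (2 * (n - Pi.single i 1 : Fin d → ℕ) k : ℤ) := by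
          funext k
          by_cases hk : k = i
          · subst hk; simp; omega
          · simp [Pi.single_eq_of_ne hk]
        have hpredsum : ∑ k, (n - Pi.single i 1 : Fin d → ℕ) k = N := by
          have h1 : (∑ k, (2 * (n - Pi.single i 1 : Fin d → ℕ) k : ℤ)) = 2 * N := by
            rw [← Finset.sum_congr rfl fun k _ => congrFun hpred k]
            simp [Finset.sum_sub_distrib, ← Finset.mul_sum, hnz]; ring
          rw [← Finset.mul_sum] at h1
          exact_mod_cast (mul_left_cancel₀ two_ne_zero h1)
        rw [hsum, hpred, norm_mul]
        have hint : ‖∫ τ in x₀..t, s i τ *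
            X (fun k => (2 * (n - Pi.single i 1 : Fin d → ℕ) k : ℤ)) τ‖ ≤
            M * ((2 * N + 1).factorial * (M * h * (d * M ^ 2 * h ^ 2) ^ N)) * |t - x₀| := by
          refine intervalIntegral.norm_integral_le_of_norm_le_const fun τ hτ => ?_
          obtain ⟨hτ1, hτ2⟩ := hsub t ht τ hτ
          rw [norm_mul]
          refine mul_le_mul (hs i τ hτ1) ((ih _ hpredsum τ hτ1).trans ?_) (norm_nonneg _) hM
          have := hτ2.trans hth
          gcongr
        have hc : ‖((2 * N + 2 : ℤ) : ℂ)‖ = 2 * N + 2 := by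
          rw [Complex.norm_intCast]; push_cast; exact abs_of_nonneg (by positivity)
        rw [hc]
        calc _ ≤ (2 * N + 2 : ℝ) *
              (M * ((2 * N + 1).factorial * (M * h * (d * M ^ 2 * h ^ 2) ^ N)) * h) := by
              gcongr
              exact hint.trans (by gcongr)
          _ = _ := by ring
    rw [hXp _ (fun i => by positivity) (hadm n) (by simp [← Finset.mul_sum]) x hx, norm_mul]
    have hint : ‖∫ t in x₀..x, w t * ∑ i, X ((fun i => (2 * n i : ℤ)) - Pi.single i 1) t‖ ≤
        M * (d * ((2 * N + 2) * ((2 * N + 1).factorial * (M * h * (d * M ^ 2 * h ^ 2) ^ N))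
          * M * h)) * h := by
      refine intervalIntegral.norm_integral_le_of_norm_le_const fun t ht => ?_
      obtain ⟨ht1, ht2⟩ := hsub x hx t ht
      rw [norm_mul]
      refine mul_le_mul (hw t ht1) ?_ (norm_nonneg _) hM
      refine (norm_sum_le_of_le _ fun i _ => hstep i t ht1 ht2).trans (by simp)
    have hc : ‖(((∑ i, (2 * n i : ℤ)) + 1 : ℤ) : ℂ)‖ = 2 * N + 3 := by
      rw [← Finset.mul_sum, hnz, Complex.norm_intCast]
      push_cast
      rw [abs_of_nonneg (by positivity)]
      ring
    rw [hc]
    have hfac : ((2 * (N + 1) + 1).factorial : ℝ) =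
        (2 * N + 3) * ((2 * N + 2) * (2 * N + 1).factorial) := by
      rw [show 2 * (N + 1) + 1 = (2 * N + 1 + 1) + 1 by ring, Nat.factorial_succ,
        Nat.factorial_succ]
      push_cast
      ring
    rw [hfac]
    calc _ ≤ (2 * N + 3 : ℝ) * _ := mul_le_mul_of_nonneg_left hint (by positivity)
      _ = _ := by ring

open Filter Topology in
/-- A series of functions whose terms are `O(|x - x₀| (K |x - x₀|²)^|n|)` has the derivative of
its zeroth term as derivative at `x₀`. -/
lemma hasDerivWithinAt_tsum_of_norm_le {d : ℕ} {S : Set ℝ} {x₀ M K : ℝ} {a : ℂ}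
    (hx₀ : x₀ ∈ S) (hM : 0 ≤ M) (hK : 0 ≤ K) {f : (Fin d → ℕ) → ℝ → ℂ}
    (hf : ∀ n, ∀ x ∈ S, ‖f n x‖ ≤ M * |x - x₀| * (K * |x - x₀| ^ 2) ^ ∑ i, n i)
    (h0 : HasDerivWithinAt (f 0) a S x₀) :
    HasDerivWithinAt (fun x => ∑' n, f n x) a S x₀ := by
  have hfx₀ : ∀ n, f n x₀ = 0 := fun n => by simpa using hf n x₀ hx₀
  rw [hasDerivWithinAt_iff_tendsto_slope] at h0 ⊢
  have hsmall : Tendsto (fun x => K * |x - x₀| ^ 2) (𝓝[S \ {x₀}] x₀) (𝓝 0) := by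
    have : Continuous fun x => K * |x - x₀| ^ 2 := by fun_prop
    simpa using (this.tendsto x₀).mono_left nhdsWithin_le_nhds
  have hslope : ∀ n, ∀ x ∈ S \ {x₀},
      ‖slope (f n) x₀ x‖ ≤ M * (K * |x - x₀| ^ 2) ^ ∑ i, n i := by
    intro n x hx
    have hpos : 0 < |x - x₀| := abs_pos.mpr (sub_ne_zero.mpr hx.2)
    rw [slope_def_module, hfx₀, sub_zero, norm_smul, norm_inv, Real.norm_eq_abs,
      inv_mul_le_iff₀ hpos]
    exact (hf n x hx.1).trans_eq (by ring)
  have hlim := tendsto_tsum_of_dominated_convergence (𝓕 := 𝓝[S \ {x₀}] x₀)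
    (f := fun x n => slope (f n) x₀ x) (g := fun n => if n = 0 then a else 0)
    ((summable_half_pow_sum d).mul_left M) ?_ ?_
  · rw [tsum_ite_eq] at hlim
    refine hlim.congr fun x => ?_
    simp only [slope_def_module, hfx₀, sub_zero, tsum_zero, Complex.real_smul, tsum_mul_left]
  · intro n
    split_ifs with hn
    · exact hn ▸ h0
    · have hne : ∑ i, n i ≠ 0 := fun h => hn <| funext fun i =>
        Finset.sum_eq_zero_iff.mp h i (Finset.mem_univ i)
      refine squeeze_zero_norm' (eventually_mem_nhdsWithin.mono fun x hx => hslope n x hx) ?_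
      simpa [hne] using (hsmall.pow (∑ i, n i)).const_mul M
  · filter_upwards [eventually_mem_nhdsWithin, hsmall.eventually_le_const one_half_pos]
      with x hx hxs n
    refine (hslope n x hx).trans ?_
    gcongr

/-- **Linear independence in the main SPPS theorem.**  With the two families of SPPS formal
powers `X̃_j` (here `Xt j`) and `X_j` (here `X m` for `j = m + (1/d)𝟙`) defined by the
recursions in the hypotheses, and the SPPS solutions
`u₁(x) = u₀(x) Σ_n (1/(2|n|)!) X̃_{2n}(x) λ^n` and
`u₂(x) = u₀(x) Σ_n (1/(2|n|+1)!) X_{2n+(1/d)𝟙}(x) λ^n`, for every `λ ∈ ℂ^d` the functions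
`u₁` and `u₂` are linearly independent over `ℂ`: if `c₁ u₁ + c₂ u₂ = 0` on `[x₁, x₂]`
then `c₁ = c₂ = 0`. -/
theorem SPPS_linear_independence
    (d : ℕ) (hd : 1 ≤ d)
    (x₁ x₂ x₀ : ℝ) (hx : x₁ < x₂) (hx₀ : x₀ ∈ Set.Icc x₁ x₂)
    (p q u₀ : ℝ → ℂ) (r : Fin d → ℝ → ℂ)
    (hp : ContDiffOn ℝ 1 p (Set.Icc x₁ x₂))
    (hq : ContinuousOn q (Set.Icc x₁ x₂))
    (hr : ∀ i, ContinuousOn (r i) (Set.Icc x₁ x₂))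
    (hpne : ∀ x ∈ Set.Icc x₁ x₂, p x ≠ 0)
    (hu₀ : ContDiffOn ℝ 2 u₀ (Set.Icc x₁ x₂))
    (hu₀ne : ∀ x ∈ Set.Icc x₁ x₂, u₀ x ≠ 0)
    (hu₀sol : ∀ x ∈ Set.Icc x₁ x₂,
      derivWithin (fun t => p t * derivWithin u₀ (Set.Icc x₁ x₂) t) (Set.Icc x₁ x₂) x
        + q x * u₀ x = 0)
    (Xt : (Fin d → ℤ) → ℝ → ℂ)
    (hXt0 : ∀ x, Xt 0 x = 1)
    (hXtneg : ∀ j : Fin d → ℤ, (∃ i, j i < 0) → ∀ x, Xt j x = 0)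
    (hXtodd : ∀ j : Fin d → ℤ, (∀ i, 0 ≤ j i) →
      (∀ i i', Odd (j i) → Odd (j i') → i = i') →
      ∀ i, Odd (j i) → ∀ x ∈ Set.Icc x₁ x₂,
        Xt j x = (((∑ i', j i') : ℤ) : ℂ) *
          ∫ t in x₀..x, r i t * u₀ t ^ 2 * Xt (j - Pi.single i 1) t)
    (hXteven : ∀ j : Fin d → ℤ, (∀ i, 0 ≤ j i) →
      (∀ i i', Odd (j i) → Odd (j i') → i = i') →
      Even (∑ i, j i) → j ≠ 0 → ∀ x ∈ Set.Icc x₁ x₂,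
        Xt j x = (((∑ i, j i) : ℤ) : ℂ) *
          ∫ t in x₀..x, (1 / (p t * u₀ t ^ 2)) * ∑ i, Xt (j - Pi.single i 1) t)
    (X : (Fin d → ℤ) → ℝ → ℂ)
    (hX0 : ∀ i : Fin d, ∀ x, X (-Pi.single i 1) x = 1 / (d : ℂ))
    (hXneg : ∀ m : Fin d → ℤ, (∃ i, m i < 0) → (∀ i, m ≠ -Pi.single i 1) →
      ∀ x, X m x = 0)
    (hXr : ∀ m : Fin d → ℤ, (∀ i, 0 ≤ m i) →
      (∀ i i', Odd (m i) → Odd (m i') → i = i') →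
      ∀ i, Odd (m i) → ∀ x ∈ Set.Icc x₁ x₂,
        X m x = (((∑ i', m i') + 1 : ℤ) : ℂ) *
          ∫ t in x₀..x, r i t * u₀ t ^ 2 * X (m - Pi.single i 1) t)
    (hXp : ∀ m : Fin d → ℤ, (∀ i, 0 ≤ m i) →
      (∀ i i', Odd (m i) → Odd (m i') → i = i') →
      Even (∑ i, m i) → ∀ x ∈ Set.Icc x₁ x₂,
        X m x = (((∑ i, m i) + 1 : ℤ) : ℂ) *
          ∫ t in x₀..x, (1 / (p t * u₀ t ^ 2)) * ∑ i, X (m - Pi.single i 1) t)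
    (lam : Fin d → ℂ)
    (u₁ u₂ : ℝ → ℂ)
    (hu₁def : ∀ x, u₁ x = u₀ x * ∑' n : Fin d → ℕ,
      (1 / (Nat.factorial (2 * ∑ i, n i) : ℂ)) *
        Xt (fun i => (2 * n i : ℤ)) x * ∏ i, lam i ^ n i)
    (hu₂def : ∀ x, u₂ x = u₀ x * ∑' n : Fin d → ℕ,
      (1 / (Nat.factorial (2 * (∑ i, n i) + 1) : ℂ)) *
        X (fun i => (2 * n i : ℤ)) x * ∏ i, lam i ^ n i):
    ∀ c₁ c₂ : ℂ, (∀ x ∈ Set.Icc x₁ x₂, c₁ * u₁ x + c₂ * u₂ x = 0) → c₁ = 0 ∧ c₂ = 0 := by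
  have hw : ContinuousOn (fun t => 1 / (p t * u₀ t ^ 2)) (Set.Icc x₁ x₂) :=
    continuousOn_const.div (hp.continuousOn.mul (hu₀.continuousOn.pow 2))
      fun x hx => mul_ne_zero (hpne x hx) (pow_ne_zero 2 (hu₀ne x hx))
  have hs : ∀ i, ContinuousOn (fun t => r i t * u₀ t ^ 2) (Set.Icc x₁ x₂) :=
    fun i => (hr i).mul (hu₀.continuousOn.pow 2)
  have hd0 : (d : ℂ) ≠ 0 := by exact_mod_cast (by omega : d ≠ 0)
  obtain ⟨Mw, hMw⟩ := isCompact_Icc.exists_bound_of_continuousOn hw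
  choose Ms hMs using fun i => isCompact_Icc.exists_bound_of_continuousOn (hs i)
  obtain ⟨M, hMwM, hMsM⟩ : ∃ M, Mw ≤ M ∧ ∀ i, Ms i ≤ M := by
    obtain ⟨B, hB⟩ := (Set.finite_range Ms).bddAbove
    exact ⟨max Mw B, le_max_left _ _, fun i => (hB ⟨i, rfl⟩).trans (le_max_right _ _)⟩
  have hM : 0 ≤ M := (norm_nonneg _).trans ((hMw x₀ hx₀).trans hMwM)
  have hXbound := fun n : Fin d → ℕ => norm_formalPower_le hd hx₀
    (fun x hx => (hMw x hx).trans hMwM) (fun i x hx => (hMs i x hx).trans (hMsM i))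
    hX0 hXneg hXr hXp _ n rfl
  have hlam : ∀ n : Fin d → ℕ, ‖∏ i, lam i ^ n i‖ ≤ (∑ i, ‖lam i‖) ^ ∑ i, n i := by
    intro n
    rw [norm_prod, ← Finset.prod_pow_eq_pow_sum]
    refine Finset.prod_le_prod (fun _ _ => norm_nonneg _) fun i _ => ?_
    rw [norm_pow]
    gcongr
    exact Finset.single_le_sum (f := fun i => ‖lam i‖) (fun _ _ => norm_nonneg _)
      (Finset.mem_univ i)
  have hbound : ∀ n : Fin d → ℕ, ∀ x ∈ Set.Icc x₁ x₂,
      ‖(1 / (Nat.factorial (2 * (∑ i, n i) + 1) : ℂ)) *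
        X (fun i => (2 * n i : ℤ)) x * ∏ i, lam i ^ n i‖ ≤
      M * |x - x₀| * ((d * M ^ 2 * ∑ i, ‖lam i‖) * |x - x₀| ^ 2) ^ ∑ i, n i := by
    intro n x hx
    have hfac : (0 : ℝ) < (2 * (∑ i, n i) + 1).factorial := by positivity
    rw [norm_mul, norm_mul, norm_div, norm_one, Complex.norm_natCast, one_div]
    calc _ ≤ (M * |x - x₀| * (d * M ^ 2 * |x - x₀| ^ 2) ^ ∑ i, n i) *
          (∑ i, ‖lam i‖) ^ ∑ i, n i := by
          exact mul_le_mul ((inv_mul_le_iff₀ hfac).mpr (hXbound n x hx)) (hlam n)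
            (norm_nonneg _) (by positivity)
      _ = _ := by
          rw [mul_assoc, ← mul_pow]
          ring
  have hXzero : HasDerivWithinAt
      (fun x => (1 / (Nat.factorial (2 * (∑ i, (0 : Fin d → ℕ) i) + 1) : ℂ)) *
        X (fun i => (2 * (0 : Fin d → ℕ) i : ℤ)) x * ∏ i, lam i ^ (0 : Fin d → ℕ) i)
      (1 / (p x₀ * u₀ x₀ ^ 2)) (Set.Icc x₁ x₂) x₀ := by
    have : Fact (x₀ ∈ Set.Icc x₁ x₂) := ⟨hx₀⟩
    have hderiv := intervalIntegral.integral_hasDerivWithinAt_right (a := x₀) (b := x₀)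
      (s := Set.Icc x₁ x₂) (t := Set.Icc x₁ x₂) (by simp)
      (hw.stronglyMeasurableAtFilter_nhdsWithin measurableSet_Icc x₀) (hw x₀ hx₀)
    have heq : ∀ x ∈ Set.Icc x₁ x₂,
        (1 / (Nat.factorial (2 * (∑ i, (0 : Fin d → ℕ) i) + 1) : ℂ)) *
          X (fun i => (2 * (0 : Fin d → ℕ) i : ℤ)) x * ∏ i, lam i ^ (0 : Fin d → ℕ) i =
        ∫ t in x₀..x, 1 / (p t * u₀ t ^ 2) := by
      intro x hx
      have hz : (fun i => (2 * (0 : Fin d → ℕ) i : ℤ)) = 0 := by ext; simp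
      rw [hz, hXp 0 (by simp) (by simp) (by simp) x hx]
      simp [hX0, hd0]
    exact hderiv.congr heq (heq x₀ hx₀)
  have hderiv := hasDerivWithinAt_tsum_of_norm_le hx₀ hM (by positivity) hbound hXzero
  intro c₁ c₂ hc
  have hu₁ : u₁ x₀ = u₀ x₀ := by
    rw [hu₁def, tsum_eq_single 0]
    · have hz : (fun i => (2 * (0 : Fin d → ℕ) i : ℤ)) = 0 := by ext; simp
      rw [hz, hXt0]
      simp
    · intro n hn
      rw [hXteven _ (fun i => by positivity) (fun i _ h => absurd h (by simp))
        (by simp [← Finset.mul_sum]) _ x₀ hx₀]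
      · simp
      · intro h
        refine hn (funext fun i => ?_)
        simpa using congrFun h i
  have hu₂ : u₂ x₀ = 0 := by
    have hterm : ∀ n : Fin d → ℕ, (1 / (Nat.factorial (2 * (∑ i, n i) + 1) : ℂ)) *
        X (fun i => (2 * n i : ℤ)) x₀ * ∏ i, lam i ^ n i = 0 :=
      fun n => norm_le_zero_iff.mp ((hbound n x₀ hx₀).trans_eq (by simp))
    rw [hu₂def]
    simp only [hterm, tsum_zero, mul_zero]
  have hc₁ : c₁ = 0 := by
    simpa [hu₁, hu₂, hu₀ne x₀ hx₀] using hc x₀ hx₀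
  refine ⟨hc₁, ?_⟩
  by_contra hc₂
  have hzero : ∀ x ∈ Set.Icc x₁ x₂, ∑' n : Fin d → ℕ,
      (1 / (Nat.factorial (2 * (∑ i, n i) + 1) : ℂ)) *
        X (fun i => (2 * n i : ℤ)) x * ∏ i, lam i ^ n i = 0 := by
    intro x hx
    have h := hc x hx
    rw [hc₁, zero_mul, zero_add, hu₂def] at h
    exact ((mul_eq_zero.mp h).resolve_left hc₂ |> mul_eq_zero.mp).resolve_left (hu₀ne x hx)
  have hderiv0 := (hasDerivWithinAt_const x₀ (Set.Icc x₁ x₂) (0 : ℂ)).congr hzero (hzero x₀ hx₀)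
  exact one_div_ne_zero (mul_ne_zero (hpne x₀ hx₀) (pow_ne_zero 2 (hu₀ne x₀ hx₀)))
    ((uniqueDiffOn_Icc hx x₀ hx₀).eq_deriv _ hderiv hderiv0)
end

section
/- For every odd admissible multiindex j ∈ ℤ^d with nonnegative entries whose odd entry is in position i, the generalized formal powers satisfy Rᵢ[u₀ X̃_{j−δᵢ}] = Rᵢ[u₀] · X̃_{j−δᵢ} + ((|j|−1) sᵢ/(p u₀)) · Σ_{i′=1}^d X̃_{j−δᵢ−δ_{i′}} on [x₁, x₂]. -/
/-- Fundamental theorem of calculus for a function continuous on a compact interval, with one-sided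
derivatives at the endpoints. -/
theorem hasDerivWithinAt_intervalIntegral_Icc {a b c : ℝ} (hc : c ∈ Set.Icc a b) {f : ℝ → ℂ}
    (hf : ContinuousOn f (Set.Icc a b)) {x : ℝ} (hx : x ∈ Set.Icc a b) :
    HasDerivWithinAt (fun y => ∫ t in c..y, f t) (f x) (Set.Icc a b) x := by
  have hab : a ≤ b := hc.1.trans hc.2
  set g : ℝ → ℂ := Set.IccExtend hab ((Set.Icc a b).domRestrict f)
  have hg : Continuous g := (continuousOn_iff_continuous_domRestrict.mp hf).Icc_extend'
  have hfg : ∀ t ∈ Set.Icc a b, g t = f t := fun t ht => Set.IccExtend_of_mem hab _ ht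
  have hint : ∀ y ∈ Set.Icc a b, ∫ t in c..y, f t = ∫ t in c..y, g t := fun y hy =>
    intervalIntegral.integral_congr fun t ht => (hfg t (Set.uIcc_subset_Icc hc hy ht)).symm
  rw [← hfg x hx]
  exact (hg.integral_hasStrictDerivAt c x).hasDerivAt.hasDerivWithinAt.congr hint (hint x hx)

section FormalPowers

variable {d : ℕ}

/-- A nonnegative multiindex with only even entries stays admissible after adding a unit vector. -/
theorem admissible_add_single {k : Fin d → ℤ} (hk : ∀ i, 0 ≤ k i ∧ Even (k i)) (i : Fin d) :
    (∀ l, 0 ≤ (k + Pi.single i 1 : Fin d → ℤ) l) ∧ Odd ((k + Pi.single i 1 : Fin d → ℤ) i) ∧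
      ∀ l l', Odd ((k + Pi.single i 1 : Fin d → ℤ) l) →
        Odd ((k + Pi.single i 1 : Fin d → ℤ) l') → l = l' := by
  have hne : ∀ l, Odd ((k + Pi.single i 1 : Fin d → ℤ) l) → l = i := by
    intro l hl
    by_contra h
    rw [Pi.add_apply, Pi.single_eq_of_ne h, add_zero] at hl
    exact Int.not_even_iff_odd.mpr hl (hk l).2
  refine ⟨fun l => ?_, ?_, fun l l' hl hl' => (hne l hl).trans (hne l' hl').symm⟩
  · have h1 : (0 : Fin d → ℤ) ≤ Pi.single i 1 := Pi.single_nonneg.mpr zero_le_one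
    exact add_nonneg (hk l).1 (h1 l)
  · simpa using (hk i).2.add_one

/-- Removing the odd unit from an odd admissible multiindex leaves only even entries. -/
theorem even_sub_single {j : Fin d → ℤ} (hj : ∀ l, 0 ≤ j l)
    (hadm : ∀ l l', Odd (j l) → Odd (j l') → l = l') {i : Fin d} (hi : Odd (j i)) (l : Fin d) :
    0 ≤ (j - Pi.single i 1 : Fin d → ℤ) l ∧ Even ((j - Pi.single i 1 : Fin d → ℤ) l) := by
  rcases eq_or_ne l i with rfl | h
  · have h0 := hj l
    obtain ⟨m, hm⟩ := hi
    simp only [Pi.sub_apply, Pi.single_eq_same]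
    exact ⟨by omega, m, by omega⟩
  · simp only [Pi.sub_apply, Pi.single_eq_of_ne h, sub_zero]
    exact ⟨hj l, Int.not_odd_iff_even.mp fun hl => h (hadm l i hl hi)⟩

variable {x₁ x₂ x₀ : ℝ} {p u₀ : ℝ → ℂ} {r s : Fin d → ℝ → ℂ} {Xt : (Fin d → ℤ) → ℝ → ℂ}

/-- The derivative of a formal power with even nonzero index. -/
theorem hasDerivWithinAt_even_formalPower (hx₀ : x₀ ∈ Set.Icc x₁ x₂)
    (hp : ContinuousOn p (Set.Icc x₁ x₂)) (hpne : ∀ x ∈ Set.Icc x₁ x₂, p x ≠ 0)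
    (hu₀ : ContinuousOn u₀ (Set.Icc x₁ x₂)) (hu₀ne : ∀ x ∈ Set.Icc x₁ x₂, u₀ x ≠ 0)
    (hXteven : ∀ j : Fin d → ℤ, (∀ i, 0 ≤ j i) →
      (∀ i i', Odd (j i) → Odd (j i') → i = i') →
      Even (∑ i, j i) → j ≠ 0 → ∀ x ∈ Set.Icc x₁ x₂,
        Xt j x = (((∑ i, j i) : ℤ) : ℂ) *
          ∫ t in x₀..x, (1 / (p t * u₀ t ^ 2)) * ∑ i, Xt (j - Pi.single i 1) t)
    {k : Fin d → ℤ} (hk : ∀ i, 0 ≤ k i ∧ Even (k i)) (hk0 : k ≠ 0)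
    (hcont : ∀ i, ContinuousOn (Xt (k - Pi.single i 1)) (Set.Icc x₁ x₂)) :
    ContinuousOn (fun t => (1 / (p t * u₀ t ^ 2)) * ∑ i, Xt (k - Pi.single i 1) t)
        (Set.Icc x₁ x₂) ∧
      ∀ x ∈ Set.Icc x₁ x₂, HasDerivWithinAt (Xt k)
        ((((∑ i, k i) : ℤ) : ℂ) * ((1 / (p x * u₀ x ^ 2)) * ∑ i, Xt (k - Pi.single i 1) x))
        (Set.Icc x₁ x₂) x := by
  have hf : ContinuousOn (fun t => (1 / (p t * u₀ t ^ 2)) * ∑ i, Xt (k - Pi.single i 1) t)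
      (Set.Icc x₁ x₂) :=
    (continuousOn_const.div (hp.mul (hu₀.pow 2))
      fun x hx => mul_ne_zero (hpne x hx) (pow_ne_zero 2 (hu₀ne x hx))).mul
      (continuousOn_finsetSum _ fun i _ => hcont i)
  have heq := hXteven k (fun i => (hk i).1)
    (fun i _ hi _ => (Int.not_even_iff_odd.mpr hi (hk i).2).elim)
    (Finset.even_sum _ fun i _ => (hk i).2) hk0
  exact ⟨hf, fun x hx => ((hasDerivWithinAt_intervalIntegral_Icc hx₀ hf hx).const_mul _).congr
    heq (heq x hx)⟩

/-- A formal power with odd index is continuous as soon as the even one below it is `C¹`. -/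
theorem continuousOn_odd_formalPower (hx : x₁ < x₂) (hx₀ : x₀ ∈ Set.Icc x₁ x₂)
    (hr : ∀ i, ContinuousOn (r i) (Set.Icc x₁ x₂))
    (hs : ∀ i, ContinuousOn (s i) (Set.Icc x₁ x₂))
    (hu₀ : ContDiffOn ℝ 1 u₀ (Set.Icc x₁ x₂))
    (hXtodd : ∀ j : Fin d → ℤ, (∀ i, 0 ≤ j i) →
      (∀ i i', Odd (j i) → Odd (j i') → i = i') →
      ∀ i, Odd (j i) → ∀ x ∈ Set.Icc x₁ x₂,
        Xt j x = (((∑ i', j i') : ℤ) : ℂ) *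
          ∫ t in x₀..x, u₀ t *
            (r i t * (u₀ t * Xt (j - Pi.single i 1) t) +
              s i t * derivWithin (fun w => u₀ w * Xt (j - Pi.single i 1) w)
                (Set.Icc x₁ x₂) t))
    {k : Fin d → ℤ} (hk : ∀ i, 0 ≤ k i ∧ Even (k i))
    (hXk : ContDiffOn ℝ 1 (Xt k) (Set.Icc x₁ x₂)) (i : Fin d) :
    ContinuousOn (Xt (k + Pi.single i 1)) (Set.Icc x₁ x₂) := by
  obtain ⟨hnn, hodd, hadm⟩ := admissible_add_single hk i
  have heq := hXtodd _ hnn hadm i hodd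
  rw [add_sub_cancel_right] at heq
  have hf := hu₀.continuousOn.mul (((hr i).mul (hu₀.continuousOn.mul hXk.continuousOn)).add
    ((hs i).mul ((hu₀.mul hXk).continuousOn_derivWithin (uniqueDiffOn_Icc hx) le_rfl)))
  exact fun x hx => (((hasDerivWithinAt_intervalIntegral_Icc hx₀ hf hx).const_mul _).congr
    heq (heq x hx)).continuousWithinAt

/-- Formal powers whose index has only nonnegative even entries are `C¹`, and those one step below
are continuous. -/
theorem contDiffOn_even_formalPower (hx : x₁ < x₂) (hx₀ : x₀ ∈ Set.Icc x₁ x₂)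
    (hp : ContinuousOn p (Set.Icc x₁ x₂)) (hpne : ∀ x ∈ Set.Icc x₁ x₂, p x ≠ 0)
    (hr : ∀ i, ContinuousOn (r i) (Set.Icc x₁ x₂))
    (hs : ∀ i, ContinuousOn (s i) (Set.Icc x₁ x₂))
    (hu₀ : ContDiffOn ℝ 1 u₀ (Set.Icc x₁ x₂)) (hu₀ne : ∀ x ∈ Set.Icc x₁ x₂, u₀ x ≠ 0)
    (hXt0 : ∀ x, Xt 0 x = 1)
    (hXtneg : ∀ j : Fin d → ℤ, (∃ i, j i < 0) → ∀ x, Xt j x = 0)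
    (hXtodd : ∀ j : Fin d → ℤ, (∀ i, 0 ≤ j i) →
      (∀ i i', Odd (j i) → Odd (j i') → i = i') →
      ∀ i, Odd (j i) → ∀ x ∈ Set.Icc x₁ x₂,
        Xt j x = (((∑ i', j i') : ℤ) : ℂ) *
          ∫ t in x₀..x, u₀ t *
            (r i t * (u₀ t * Xt (j - Pi.single i 1) t) +
              s i t * derivWithin (fun w => u₀ w * Xt (j - Pi.single i 1) w)
                (Set.Icc x₁ x₂) t))
    (hXteven : ∀ j : Fin d → ℤ, (∀ i, 0 ≤ j i) →
      (∀ i i', Odd (j i) → Odd (j i') → i = i') →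
      Even (∑ i, j i) → j ≠ 0 → ∀ x ∈ Set.Icc x₁ x₂,
        Xt j x = (((∑ i, j i) : ℤ) : ℂ) *
          ∫ t in x₀..x, (1 / (p t * u₀ t ^ 2)) * ∑ i, Xt (j - Pi.single i 1) t)
    (k : Fin d → ℤ) (hk : ∀ i, 0 ≤ k i ∧ Even (k i)) :
    ContDiffOn ℝ 1 (Xt k) (Set.Icc x₁ x₂) ∧
      ∀ i, ContinuousOn (Xt (k - Pi.single i 1)) (Set.Icc x₁ x₂) := by
  induction hn : (∑ i, k i).toNat using Nat.strong_induction_on generalizing k with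
  | _ n ih =>
  have hcont : ∀ i, ContinuousOn (Xt (k - Pi.single i 1)) (Set.Icc x₁ x₂) := by
    intro i
    rcases (hk i).1.eq_or_lt with h0 | hpos
    · have hz : Xt (k - Pi.single i 1) = fun _ => 0 :=
        funext (hXtneg _ ⟨i, by simp [← h0]⟩)
      rw [hz]
      exact continuousOn_const
    · have hk' : ∀ l, 0 ≤ (k - Pi.single i 2 : Fin d → ℤ) l ∧
          Even ((k - Pi.single i 2 : Fin d → ℤ) l) := by
        intro l
        rcases eq_or_ne l i with rfl | h
        · obtain ⟨m, hm⟩ := (hk l).2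
          simp only [Pi.sub_apply, Pi.single_eq_same]
          exact ⟨by omega, m - 1, by omega⟩
        · simpa [h] using hk l
      have hsum : ∑ l, (k - Pi.single i 2 : Fin d → ℤ) l = ∑ l, k l - 2 := by
        simp [Finset.sum_sub_distrib]
      have hle : k i ≤ ∑ l, k l :=
        Finset.single_le_sum (fun l _ => (hk l).1) (Finset.mem_univ i)
      have hstep := continuousOn_odd_formalPower hx hx₀ hr hs hu₀ hXtodd hk'
        (ih _ (by omega) _ hk' rfl).1 i
      have hidx : k - Pi.single i 2 + Pi.single i 1 = k - Pi.single i 1 := by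
        rw [show (2 : ℤ) = 1 + 1 from rfl, Pi.single_add]
        abel
      rwa [hidx] at hstep
  refine ⟨?_, hcont⟩
  by_cases hk0 : k = 0
  · rw [hk0, show Xt 0 = fun _ => 1 from funext hXt0]
    exact contDiffOn_const
  · obtain ⟨hf, hderiv⟩ := hasDerivWithinAt_even_formalPower hx₀ hp hpne hu₀.continuousOn hu₀ne
      hXteven hk hk0 hcont
    rw [contDiffOn_one_iff_derivWithin (uniqueDiffOn_Icc hx)]
    exact ⟨fun x hx' => (hderiv x hx').differentiableWithinAt,
      (continuousOn_const.mul hf).congr fun x hx' =>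
        (hderiv x hx').derivWithin (uniqueDiffOn_Icc hx x hx')⟩

end FormalPowers


/-- **Formula for `Rᵢ[u₀ X̃_{j−δᵢ}]` in the generalized setting.**  With `Rᵢ[y] = rᵢ y + sᵢ y′`
and the generalized SPPS formal powers `X̃_j` (here `Xt j`) defined by the recursion
`X̃_0 = 1`; `X̃_j = 0` if some entry is negative; for admissible `j ≥ 0` (at most one entry odd),
`X̃_j = |j| ∫_{x₀}^x u₀ Rᵢ[u₀ X̃_{j−δᵢ}]` when `j` is odd with odd entry in position `i`, and
`X̃_j = |j| ∫_{x₀}^x (1/(p u₀²)) Σᵢ X̃_{j−δᵢ}` when `j` is even;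
one has, for every odd admissible `j ≥ 0` with odd entry in position `i`,
`Rᵢ[u₀ X̃_{j−δᵢ}] = Rᵢ[u₀] X̃_{j−δᵢ} + ((|j|−1) sᵢ/(p u₀)) Σ_{i′} X̃_{j−δᵢ−δ_{i′}}`
on `[x₁, x₂]` (derivatives within `[x₁, x₂]`). -/
theorem generalized_Ri_formula
    (d : ℕ) (hd : 1 ≤ d)
    (x₁ x₂ x₀ : ℝ) (hx : x₁ < x₂) (hx₀ : x₀ ∈ Set.Icc x₁ x₂)
    (p q u₀ : ℝ → ℂ) (r s : Fin d → ℝ → ℂ)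
    (hp : ContDiffOn ℝ 1 p (Set.Icc x₁ x₂))
    (hq : ContinuousOn q (Set.Icc x₁ x₂))
    (hr : ∀ i, ContinuousOn (r i) (Set.Icc x₁ x₂))
    (hs : ∀ i, ContinuousOn (s i) (Set.Icc x₁ x₂))
    (hpne : ∀ x ∈ Set.Icc x₁ x₂, p x ≠ 0)
    (hu₀ : ContDiffOn ℝ 2 u₀ (Set.Icc x₁ x₂))
    (hu₀ne : ∀ x ∈ Set.Icc x₁ x₂, u₀ x ≠ 0)
    (hu₀sol : ∀ x ∈ Set.Icc x₁ x₂,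
      derivWithin (fun t => p t * derivWithin u₀ (Set.Icc x₁ x₂) t) (Set.Icc x₁ x₂) x
        + q x * u₀ x = 0)
    (Xt : (Fin d → ℤ) → ℝ → ℂ)
    (hXt0 : ∀ x, Xt 0 x = 1)
    (hXtneg : ∀ j : Fin d → ℤ, (∃ i, j i < 0) → ∀ x, Xt j x = 0)
    (hXtodd : ∀ j : Fin d → ℤ, (∀ i, 0 ≤ j i) →
      (∀ i i', Odd (j i) → Odd (j i') → i = i') →
      ∀ i, Odd (j i) → ∀ x ∈ Set.Icc x₁ x₂,
        Xt j x = (((∑ i', j i') : ℤ) : ℂ) *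
          ∫ t in x₀..x, u₀ t *
            (r i t * (u₀ t * Xt (j - Pi.single i 1) t) +
              s i t * derivWithin (fun w => u₀ w * Xt (j - Pi.single i 1) w)
                (Set.Icc x₁ x₂) t))
    (hXteven : ∀ j : Fin d → ℤ, (∀ i, 0 ≤ j i) →
      (∀ i i', Odd (j i) → Odd (j i') → i = i') →
      Even (∑ i, j i) → j ≠ 0 → ∀ x ∈ Set.Icc x₁ x₂,
        Xt j x = (((∑ i, j i) : ℤ) : ℂ) *
          ∫ t in x₀..x, (1 / (p t * u₀ t ^ 2)) * ∑ i, Xt (j - Pi.single i 1) t) :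
    ∀ j : Fin d → ℤ, (∀ i, 0 ≤ j i) →
      (∀ i i', Odd (j i) → Odd (j i') → i = i') →
      ∀ i, Odd (j i) → ∀ x ∈ Set.Icc x₁ x₂,
        r i x * (u₀ x * Xt (j - Pi.single i 1) x) +
            s i x * derivWithin (fun w => u₀ w * Xt (j - Pi.single i 1) w)
              (Set.Icc x₁ x₂) x
          = (r i x * u₀ x + s i x * derivWithin u₀ (Set.Icc x₁ x₂) x) *
              Xt (j - Pi.single i 1) x
            + (((∑ i', j i') - 1 : ℤ) : ℂ) * s i x / (p x * u₀ x) *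
                ∑ i', Xt (j - Pi.single i 1 - Pi.single i' 1) x := by
  intro j hj hadm i hi x hxI
  have hk := even_sub_single hj hadm hi
  have hsum : ∑ l, (j - Pi.single i 1 : Fin d → ℤ) l = ∑ l, j l - 1 := by
    simp [Finset.sum_sub_distrib]
  generalize j - Pi.single i 1 = k at hk hsum ⊢
  rw [← hsum]
  have hu₁ : ContDiffOn ℝ 1 u₀ (Set.Icc x₁ x₂) := hu₀.of_le one_le_two
  have hcont := (contDiffOn_even_formalPower hx hx₀ hp.continuousOn hpne hr hs hu₁ hu₀ne
    hXt0 hXtneg hXtodd hXteven k hk).2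
  have hderiv : HasDerivWithinAt (Xt k)
      ((((∑ l, k l) : ℤ) : ℂ) * ((1 / (p x * u₀ x ^ 2)) * ∑ l, Xt (k - Pi.single l 1) x))
      (Set.Icc x₁ x₂) x := by
    by_cases hk0 : k = 0
    · subst hk0
      rw [show Xt 0 = fun _ => 1 from funext hXt0]
      simpa using hasDerivWithinAt_const x (Set.Icc x₁ x₂) (1 : ℂ)
    · exact (hasDerivWithinAt_even_formalPower hx₀ hp.continuousOn hpne hu₁.continuousOn hu₀ne
        hXteven hk hk0 hcont).2 x hxI
  have hu := (hu₁.differentiableOn one_ne_zero x hxI).hasDerivWithinAt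
  rw [(hu.fun_mul hderiv).derivWithin (uniqueDiffOn_Icc hx x hxI)]
  have h1 := hpne x hxI
  have h2 := hu₀ne x hxI
  field_simp
  ring
end

section
/- (Reduction to a single spectral parameter.) Suppose r₁ = r₂ = ⋯ = r_d = r. Then for every admissible multiindex j ∈ ℤ^d with nonnegative entries, X̃_j = c̃_j · Y_{|j|}, where (Y_k)_{k≥0} are the classical one-parameter formal powers defined by Y₀ = 1, Y_k = k ∫ r u₀² Y_{k−1} for k odd, and Y_k = k ∫ (1/(p u₀²)) Y_{k−1} for k even. -/
theorem Finset.sum_sub_pi_single {ι : Type*} [Fintype ι] [DecidableEq ι] (j : ι → ℤ) (i : ι) :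
    ∑ k, (j - Pi.single i 1 : ι → ℤ) k = ∑ k, j k - 1 := by
  simp [Finset.sum_sub_distrib]

theorem Finset.odd_sum_of_unique_odd {ι : Type*} [Fintype ι] [DecidableEq ι] (j : ι → ℤ) (i : ι)
    (hi : Odd (j i)) (h : ∀ k, Odd (j k) → k = i) : Odd (∑ k, j k) := by
  rw [← Finset.add_sum_erase _ _ (Finset.mem_univ i)]
  refine hi.add_even (Finset.even_sum _ fun k hk => ?_)
  by_contra hk'
  exact (Finset.ne_of_mem_erase hk) (h k (Int.not_even_iff_odd.mp hk'))

/-- **Reduction to a single spectral parameter.**  Suppose `r₁ = ⋯ = r_d = r`.  With the SPPS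
formal powers `X̃_j` (here `Xt j`) and the counts `c̃_j` (here `ct j`) defined by the
recursions in the hypotheses, and `(Y_k)` the classical one-parameter formal powers
(`Y₀ = 1`, `Y_k = k ∫_{x₀}^x r u₀² Y_{k−1}` for `k` odd, `Y_k = k ∫_{x₀}^x (1/(p u₀²)) Y_{k−1}`
for `k` even), one has `X̃_j = c̃_j Y_{|j|}` on `[x₁, x₂]` for every admissible `j ≥ 0`. -/
theorem reduction_equal_coefficients
    (d : ℕ) (hd : 1 ≤ d)
    (x₁ x₂ x₀ : ℝ) (hx : x₁ < x₂) (hx₀ : x₀ ∈ Set.Icc x₁ x₂)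
    (p q u₀ : ℝ → ℂ) (r : Fin d → ℝ → ℂ)
    (hp : ContDiffOn ℝ 1 p (Set.Icc x₁ x₂))
    (hq : ContinuousOn q (Set.Icc x₁ x₂))
    (hr : ∀ i, ContinuousOn (r i) (Set.Icc x₁ x₂))
    (hpne : ∀ x ∈ Set.Icc x₁ x₂, p x ≠ 0)
    (hu₀ : ContDiffOn ℝ 2 u₀ (Set.Icc x₁ x₂))
    (hu₀ne : ∀ x ∈ Set.Icc x₁ x₂, u₀ x ≠ 0)
    (hu₀sol : ∀ x ∈ Set.Icc x₁ x₂,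
      derivWithin (fun t => p t * derivWithin u₀ (Set.Icc x₁ x₂) t) (Set.Icc x₁ x₂) x
        + q x * u₀ x = 0)
    (Xt : (Fin d → ℤ) → ℝ → ℂ)
    (hXt0 : ∀ x, Xt 0 x = 1)
    (hXtneg : ∀ j : Fin d → ℤ, (∃ i, j i < 0) → ∀ x, Xt j x = 0)
    (hXtodd : ∀ j : Fin d → ℤ, (∀ i, 0 ≤ j i) →
      (∀ i i', Odd (j i) → Odd (j i') → i = i') →
      ∀ i, Odd (j i) → ∀ x ∈ Set.Icc x₁ x₂,
        Xt j x = (((∑ i', j i') : ℤ) : ℂ) *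
          ∫ t in x₀..x, r i t * u₀ t ^ 2 * Xt (j - Pi.single i 1) t)
    (hXteven : ∀ j : Fin d → ℤ, (∀ i, 0 ≤ j i) →
      (∀ i i', Odd (j i) → Odd (j i') → i = i') →
      Even (∑ i, j i) → j ≠ 0 → ∀ x ∈ Set.Icc x₁ x₂,
        Xt j x = (((∑ i, j i) : ℤ) : ℂ) *
          ∫ t in x₀..x, (1 / (p t * u₀ t ^ 2)) * ∑ i, Xt (j - Pi.single i 1) t)
    (r₀ : ℝ → ℂ) (hreq : ∀ i, r i = r₀)
    (ct : (Fin d → ℤ) → ℕ)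
    (hct0 : ct 0 = 1)
    (hctneg : ∀ j : Fin d → ℤ, (∃ i, j i < 0) → ct j = 0)
    (hctodd : ∀ j : Fin d → ℤ, (∀ i, 0 ≤ j i) →
      (∀ i i', Odd (j i) → Odd (j i') → i = i') →
      ∀ i, Odd (j i) → ct j = ct (j - Pi.single i 1))
    (hcteven : ∀ j : Fin d → ℤ, (∀ i, 0 ≤ j i) →
      (∀ i i', Odd (j i) → Odd (j i') → i = i') →
      Even (∑ i, j i) → j ≠ 0 → ct j = ∑ i, ct (j - Pi.single i 1))
    (Y : ℕ → ℝ → ℂ)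
    (hY0 : ∀ x, Y 0 x = 1)
    (hYodd : ∀ k : ℕ, Odd k → ∀ x ∈ Set.Icc x₁ x₂,
      Y k x = (k : ℂ) * ∫ t in x₀..x, r₀ t * u₀ t ^ 2 * Y (k - 1) t)
    (hYeven : ∀ k : ℕ, Even k → k ≠ 0 → ∀ x ∈ Set.Icc x₁ x₂,
      Y k x = (k : ℂ) * ∫ t in x₀..x, (1 / (p t * u₀ t ^ 2)) * Y (k - 1) t) :
    ∀ j : Fin d → ℤ, (∀ i, 0 ≤ j i) →
      (∀ i i', Odd (j i) → Odd (j i') → i = i') →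
      ∀ x ∈ Set.Icc x₁ x₂,
        Xt j x = (ct j : ℂ) * Y (∑ i, j i).toNat x := by
  suffices key : ∀ n : ℕ, ∀ j : Fin d → ℤ, (∀ i, 0 ≤ j i) →
      (∀ i i', Odd (j i) → Odd (j i') → i = i') → ∑ i, j i = (n : ℤ) →
      ∀ x ∈ Set.Icc x₁ x₂, Xt j x = (ct j : ℂ) * Y n x by
    intro j hj hadm x hxI
    exact key _ j hj hadm (Int.toNat_of_nonneg (Finset.sum_nonneg fun i _ => hj i)).symm x hxI
  intro n
  induction n with
  | zero =>
    intro j hj _ hsum x _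
    have hj0 : j = 0 := by
      funext i
      exact (Finset.sum_eq_zero_iff_of_nonneg fun i _ => hj i).mp (by simpa using hsum) i
        (Finset.mem_univ i)
    subst hj0
    simp [hXt0, hct0, hY0]
  | succ n ih =>
    intro j hj hadm hsum x hxI
    have hsub : Set.uIcc x₀ x ⊆ Set.Icc x₁ x₂ := Set.uIcc_subset_Icc hx₀ hxI
    have hsum' : ∀ i, ∑ k, (j - Pi.single i 1 : Fin d → ℤ) k = (n : ℤ) := fun i => by
      rw [Finset.sum_sub_pi_single, hsum]; push_cast; ring
    by_cases hodd : ∃ i, Odd (j i)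
    · obtain ⟨i, hi⟩ := hodd
      have hn : Odd (n + 1) := by
        have := Finset.odd_sum_of_unique_odd j i hi fun k hk => hadm k i hk hi
        rw [hsum] at this
        exact_mod_cast this
      have heven : ∀ k, Even ((j - Pi.single i 1 : Fin d → ℤ) k) := by
        intro k
        by_cases hk : k = i
        · subst hk
          simpa using hi.sub_odd odd_one
        · simpa [hk] using Int.not_odd_iff_even.mp fun h => hk (hadm k i h hi)
      have hnonneg : ∀ k, 0 ≤ (j - Pi.single i 1 : Fin d → ℤ) k := by
        intro k
        by_cases hk : k = i
        · subst hk
          obtain ⟨m, hm⟩ := hi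
          have := hj k
          simp only [Pi.sub_apply, Pi.single_eq_same]
          omega
        · simpa [hk] using hj k
      rw [hXtodd j hj hadm i hi x hxI, hctodd j hj hadm i hi, hYodd _ hn x hxI, hsum, hreq,
        mul_left_comm (ct _ : ℂ), ← intervalIntegral.integral_const_mul (ct _ : ℂ)]
      push_cast
      congr 1
      refine intervalIntegral.integral_congr fun t ht => ?_
      rw [ih _ hnonneg (fun a _ ha => absurd (heven a) (Int.not_even_iff_odd.mpr ha)) (hsum' i) t
        (hsub ht)]
      ring
    · have heven : ∀ k, Even (j k) := fun k => Int.not_odd_iff_even.mp fun h => hodd ⟨k, h⟩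
      have hsumeven : Even (∑ i, j i) := Finset.even_sum _ fun k _ => heven k
      have hn : Even (n + 1) := by
        rw [hsum] at hsumeven
        exact_mod_cast hsumeven
      have hj0 : j ≠ 0 := by
        rintro rfl
        simp at hsum
        omega
      have hstep : ∀ i, ∀ t ∈ Set.Icc x₁ x₂,
          Xt (j - Pi.single i 1) t = (ct (j - Pi.single i 1) : ℂ) * Y n t := by
        intro i t ht
        by_cases hneg : ∃ k, (j - Pi.single i 1 : Fin d → ℤ) k < 0
        · simp [hXtneg _ hneg, hctneg _ hneg]
        · push Not at hneg
          have huniq : ∀ k, Odd ((j - Pi.single i 1 : Fin d → ℤ) k) → k = i := by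
            intro k hk
            by_contra hki
            exact hodd ⟨k, by simpa [hki] using hk⟩
          exact ih _ hneg (fun a b ha hb => (huniq a ha).trans (huniq b hb).symm) (hsum' i) t ht
      rw [hXteven j hj hadm hsumeven hj0 x hxI, hYeven _ hn n.succ_ne_zero x hxI, hsum,
        mul_left_comm (ct _ : ℂ),
        ← intervalIntegral.integral_const_mul (ct _ : ℂ)]
      push_cast
      congr 1
      refine intervalIntegral.integral_congr fun t ht => ?_
      rw [hcteven j hj hadm hsumeven hj0, Nat.cast_sum,
        Finset.sum_congr rfl fun i _ => hstep i t (hsub ht), ← Finset.sum_mul]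
      ring
end
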